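/- arXiv:2203.11561 — 6 statements merged into one kernel-verified Lean document; each statement's English description precedes it below -/
import Mathlib

section
/- Let S be a random k×d real matrix satisfying the Length Preserving Property, let x, y ∈ ℝ^d be fixed vectors, and let η, μ be noise vectors as in the context with m₂, m₄ < ∞ and with E[‖S(x−y)‖₂⁴] finite. Then the estimator Ê_gen := ‖(Sx+η) − (Sy+μ)‖₂² − 2k·m₂ has variance Var[Ê_gen] = Var[‖S(x−y)‖₂²] + 8·m₂·‖x−y‖₂² + 2k·m₄ + 2k·m₂². -/
open MeasureTheory ProbabilityTheory Finset
open scoped ENNReal NNReal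

/-- Binomial expansion of the moments of a difference of two independent random variables. -/
theorem ProbabilityTheory.IndepFun.integral_sub_pow
    {Ω : Type*} [MeasurableSpace Ω] {P : Measure Ω} {X Y : Ω → ℝ} {n : ℕ}
    (h : IndepFun X Y P)
    (hX : ∀ m ≤ n, Integrable (fun ω => X ω ^ m) P)
    (hY : ∀ m ≤ n, Integrable (fun ω => Y ω ^ m) P) :
    Integrable (fun ω => (X ω - Y ω) ^ n) P ∧
      ∫ ω, (X ω - Y ω) ^ n ∂P
        = ∑ m ∈ range (n + 1),
            (-1) ^ (m + n) * ((∫ ω, X ω ^ m ∂P) * ∫ ω, Y ω ^ (n - m) ∂P) * n.choose m := by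
  have hind (m l : ℕ) : IndepFun (fun ω => X ω ^ m) (fun ω => Y ω ^ l) P :=
    h.comp (φ := fun t => t ^ m) (ψ := fun t => t ^ l) (by fun_prop) (by fun_prop)
  have hint : ∀ m ∈ range (n + 1), Integrable
      (fun ω => (-1) ^ (m + n) * (X ω ^ m * Y ω ^ (n - m)) * (n.choose m : ℝ)) P := by
    intro m hm
    have hm' : m ≤ n := by simpa [Nat.lt_succ_iff] using hm
    exact (((hind m (n - m)).integrable_mul (hX m hm') (hY _ (Nat.sub_le n m))).const_mul
      _).mul_const _
  have hexp : (fun ω => (X ω - Y ω) ^ n) = fun ω => ∑ m ∈ range (n + 1),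
      (-1) ^ (m + n) * (X ω ^ m * Y ω ^ (n - m)) * (n.choose m : ℝ) := by
    funext ω
    rw [sub_pow]
    simp only [mul_assoc]
  rw [hexp]
  refine ⟨integrable_finsetSum _ hint, ?_⟩
  rw [integral_finsetSum _ hint]
  refine Finset.sum_congr rfl fun m hm => ?_
  have hm' : m ≤ n := by simpa [Nat.lt_succ_iff] using hm
  rw [integral_mul_const, integral_const_mul,
    (hind m (n - m)).integral_fun_mul_eq_mul_integral (hX m hm').aestronglyMeasurable
      (hY _ (Nat.sub_le n m)).aestronglyMeasurable]

/-- The variance of the squared norm of a random vector perturbed by independent noise with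
pairwise independent coordinates whose first and third moments vanish. -/
theorem variance_sum_add_sq {Ω ι : Type*} [MeasurableSpace Ω] [Fintype ι]
    {P : Measure Ω} [IsProbabilityMeasure P] {V W : Ω → ι → ℝ} {s q : ℝ}
    (hVm : Measurable V) (hWm : Measurable W)
    (hVW : IndepFun V W P)
    (hW : Pairwise fun i j => IndepFun (fun ω => W ω i) (fun ω => W ω j) P)
    (hV2 : ∀ i, MemLp (fun ω => V ω i ^ 2) 2 P)
    (hW2 : ∀ i, MemLp (fun ω => W ω i ^ 2) 2 P)
    (h1 : ∀ i, ∫ ω, W ω i ∂P = 0) (h2 : ∀ i, ∫ ω, W ω i ^ 2 ∂P = s)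
    (h3 : ∀ i, ∫ ω, W ω i ^ 3 ∂P = 0) (h4 : ∀ i, ∫ ω, W ω i ^ 4 ∂P = q) :
    variance (fun ω => ∑ i, (V ω i + W ω i) ^ 2) P
      = variance (fun ω => ∑ i, V ω i ^ 2) P
        + 4 * s * (∫ ω, ∑ i, V ω i ^ 2 ∂P) + Fintype.card ι * (q - s ^ 2) := by
  have hVi (i : ι) : Measurable fun ω => V ω i := (measurable_pi_apply i).comp hVm
  have hWi (i : ι) : Measurable fun ω => W ω i := (measurable_pi_apply i).comp hWm
  have hfac {f g : (ι → ℝ) → ℝ} (hf : Measurable f) (hg : Measurable g) :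
      ∫ ω, f (V ω) * g (W ω) ∂P = (∫ ω, f (V ω) ∂P) * ∫ ω, g (W ω) ∂P :=
    (hVW.comp hf hg).integral_fun_mul_eq_mul_integral
      (hf.comp hVm).aestronglyMeasurable (hg.comp hWm).aestronglyMeasurable
  have hVWi (i : ι) : MemLp (fun ω => V ω i * W ω i) 2 P := by
    refine (memLp_two_iff_integrable_sq ((hVi i).mul (hWi i)).aestronglyMeasurable).2 ?_
    simp only [Pi.mul_apply, mul_pow]
    have hind : IndepFun (fun ω => V ω i ^ 2) (fun ω => W ω i ^ 2) P :=
      hVW.comp (φ := fun v : ι → ℝ => v i ^ 2) (ψ := fun w : ι → ℝ => w i ^ 2)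
        (by fun_prop) (by fun_prop)
    exact hind.integrable_mul ((hV2 i).integrable (by simp)) ((hW2 i).integrable (by simp))
  have hmean (i : ι) : ∫ ω, V ω i * W ω i ∂P = 0 := by
    rw [hfac (f := fun v => v i) (g := fun w => w i) (by fun_prop) (by fun_prop), h1, mul_zero]
  have hA : MemLp (fun ω => ∑ i, V ω i ^ 2) 2 P := memLp_finsetSum _ fun i _ => hV2 i
  have hB : MemLp (fun ω => ∑ i, W ω i ^ 2) 2 P := memLp_finsetSum _ fun i _ => hW2 i
  have hC : MemLp (fun ω => ∑ i, V ω i * W ω i) 2 P := memLp_finsetSum _ fun i _ => hVWi i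
  have hAB : IndepFun (fun ω => ∑ i, V ω i ^ 2) (fun ω => ∑ i, W ω i ^ 2) P :=
    hVW.comp (φ := fun v : ι → ℝ => ∑ i, v i ^ 2) (ψ := fun w : ι → ℝ => ∑ i, w i ^ 2)
      (by fun_prop) (by fun_prop)
  have hvarB : variance (fun ω => ∑ i, W ω i ^ 2) P = Fintype.card ι * (q - s ^ 2) := by
    have hsum := IndepFun.variance_sum (μ := P) (s := Finset.univ)
      (X := fun i ω => W ω i ^ 2) (fun i _ => hW2 i)
      (fun i _ j _ hij => (hW hij).comp (φ := fun t => t ^ 2) (ψ := fun t => t ^ 2)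
        (by fun_prop) (by fun_prop))
    have hvar (i : ι) : variance (fun ω => W ω i ^ 2) P = q - s ^ 2 := by
      rw [variance_eq_sub (hW2 i), h2]
      simp only [Pi.pow_apply, ← pow_mul]
      rw [h4]
    rw [show (fun ω => ∑ i, W ω i ^ 2) = ∑ i, fun ω => W ω i ^ 2 by
      ext ω; simp, hsum]
    simp only [hvar, Finset.sum_const, Finset.card_univ, nsmul_eq_mul]
  have hvarC : variance (fun ω => ∑ i, V ω i * W ω i) P
      = s * ∫ ω, ∑ i, V ω i ^ 2 ∂P := by
    rw [variance_fun_sum (X := fun i ω => V ω i * W ω i) hVWi,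
      integral_finsetSum _ fun i _ => (hV2 i).integrable (by simp), Finset.mul_sum]
    refine Finset.sum_congr rfl fun i _ => ?_
    have hcov (j : ι) : cov[fun ω => V ω i * W ω i, fun ω => V ω j * W ω j; P]
        = (∫ ω, V ω i * V ω j ∂P) * ∫ ω, W ω i * W ω j ∂P := by
      rw [covariance_eq_sub (hVWi i) (hVWi j), hmean, zero_mul, sub_zero,
        ← hfac (f := fun v => v i * v j) (g := fun w => w i * w j) (by fun_prop) (by fun_prop)]
      refine integral_congr_ae (.of_forall fun ω => ?_)
      simp only [Pi.mul_apply]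
      ring
    rw [Finset.sum_eq_single i]
    · rw [hcov]
      simp only [← pow_two]
      rw [h2, mul_comm]
    · intro j _ hji
      rw [hcov, (hW hji.symm).integral_fun_mul_eq_mul_integral
        (hWi i).aestronglyMeasurable (hWi j).aestronglyMeasurable, h1, zero_mul, mul_zero]
    · simp
  have hcovAC : cov[fun ω => ∑ i, V ω i ^ 2, fun ω => ∑ i, V ω i * W ω i; P] = 0 := by
    rw [covariance_fun_sum_fun_sum (X := fun i ω => V ω i ^ 2)
      (Y := fun i ω => V ω i * W ω i) hV2 hVWi]
    refine Finset.sum_eq_zero fun i _ => Finset.sum_eq_zero fun j _ => ?_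
    rw [covariance_eq_sub (hV2 i) (hVWi j), hmean, mul_zero, sub_zero]
    simp only [Pi.mul_apply, ← mul_assoc]
    rw [hfac (f := fun v => v i ^ 2 * v j) (g := fun w => w j) (by fun_prop) (by fun_prop),
      h1, mul_zero]
  have hcovBC : cov[fun ω => ∑ i, W ω i ^ 2, fun ω => ∑ i, V ω i * W ω i; P] = 0 := by
    rw [covariance_fun_sum_fun_sum (X := fun i ω => W ω i ^ 2)
      (Y := fun i ω => V ω i * W ω i) hW2 hVWi]
    refine Finset.sum_eq_zero fun i _ => Finset.sum_eq_zero fun j _ => ?_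
    rw [covariance_eq_sub (hW2 i) (hVWi j), hmean, mul_zero, sub_zero]
    simp only [Pi.mul_apply, mul_left_comm _ (V _ j)]
    rw [hfac (f := fun v => v j) (g := fun w => w i ^ 2 * w j) (by fun_prop) (by fun_prop)]
    have hzero : ∫ ω, W ω i ^ 2 * W ω j ∂P = 0 := by
      rcases eq_or_ne i j with rfl | hij
      · simpa only [← pow_succ] using h3 i
      · have hind : IndepFun (fun ω => W ω i ^ 2) (fun ω => W ω j) P :=
          (hW hij).comp (φ := fun t => t ^ 2) (ψ := id) (by fun_prop) measurable_id
        rw [hind.integral_fun_mul_eq_mul_integral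
          ((hWi i).pow_const 2).aestronglyMeasurable (hWi j).aestronglyMeasurable, h1, mul_zero]
    rw [hzero, mul_zero]
  have hexp : (fun ω => ∑ i, (V ω i + W ω i) ^ 2) = fun ω =>
      ((fun ω => ∑ i, V ω i ^ 2) + fun ω => ∑ i, W ω i ^ 2) ω
        + 2 * ∑ i, V ω i * W ω i := by
    funext ω
    simp only [Pi.add_apply, Finset.mul_sum, ← Finset.sum_add_distrib]
    exact Finset.sum_congr rfl fun i _ => by ring
  rw [hexp, variance_fun_add (hA.add hB) (hC.const_mul 2), hAB.variance_add hA hB,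
    variance_const_mul, covariance_const_mul_right, covariance_add_left hA hB hC,
    hcovAC, hcovBC, hvarB, hvarC]
  ring

/-- For a random `k × d` matrix `S` satisfying the Length Preserving
Property, fixed vectors `x y : ℝ^d`, and noise `η = N ∘ Sum.inl`, `μ = N ∘ Sum.inr`
whose `2k` coordinates are i.i.d. samples of a mean-zero distribution `𝒟` with finite
second and fourth moments `m₂, m₄`, independent of `S`, and with `E[‖S(x-y)‖₂⁴]` finite,
the estimator `Ê_gen = ‖(Sx+η) - (Sy+μ)‖₂² - 2 k m₂` has variance
`Var[Ê_gen] = Var[‖S(x-y)‖₂²] + 8 m₂ ‖x-y‖₂² + 2 k m₄ + 2 k m₂²`. -/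
theorem variance_general_estimator
    {Ω : Type*} [MeasurableSpace Ω] (Pr : Measure Ω) [IsProbabilityMeasure Pr]
    (k d : ℕ)
    (S : Ω → Fin k → Fin d → ℝ) (hSmeas : Measurable S)
    (hLPP : ∀ z : Fin d → ℝ,
      (∫ ω, ∑ i, (∑ j, S ω i j * z j) ^ 2 ∂Pr) = ∑ j, (z j) ^ 2)
    (𝒟 : Measure ℝ) [IsProbabilityMeasure 𝒟]
    (hmean_int : Integrable (fun t => t) 𝒟)
    (hmean : (∫ t, t ∂𝒟) = 0)
    (hm₂_int : Integrable (fun t => t ^ 2) 𝒟)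
    (hm₄_int : Integrable (fun t => t ^ 4) 𝒟)
    (m₂ m₄ : ℝ) (hm₂ : m₂ = ∫ t, t ^ 2 ∂𝒟) (hm₄ : m₄ = ∫ t, t ^ 4 ∂𝒟)
    (N : Ω → (Fin k ⊕ Fin k) → ℝ) (hNmeas : Measurable N)
    (hNlaw : Measure.map N Pr = Measure.pi (fun _ => 𝒟))
    (hindep : IndepFun S N Pr)
    (x y : Fin d → ℝ)
    (hS4int : Integrable
      (fun ω => (∑ i, (∑ j, S ω i j * (x j - y j)) ^ 2) ^ 2) Pr) :
    variance (fun ω =>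
        (∑ i, ((∑ j, S ω i j * x j) + N ω (Sum.inl i)
          - ((∑ j, S ω i j * y j) + N ω (Sum.inr i))) ^ 2)
        - 2 * (k : ℝ) * m₂) Pr
      = variance (fun ω => ∑ i, (∑ j, S ω i j * (x j - y j)) ^ 2) Pr
        + 8 * m₂ * (∑ j, (x j - y j) ^ 2)
        + 2 * (k : ℝ) * m₄ + 2 * (k : ℝ) * m₂ ^ 2 := by
  have hNi (a : Fin k ⊕ Fin k) : Measurable fun ω => N ω a :=
    (measurable_pi_apply a).comp hNmeas
  have hNalaw (a : Fin k ⊕ Fin k) : Measure.map (fun ω => N ω a) Pr = 𝒟 := by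
    rw [← (measurePreserving_eval (fun _ : Fin k ⊕ Fin k => 𝒟) a).map_eq, ← hNlaw,
      Measure.map_map (measurable_pi_apply a) hNmeas]
    rfl
  have hNind : iIndepFun (fun a ω => N ω a) Pr := by
    rw [iIndepFun_iff_map_fun_eq_pi_map fun a => (hNi a).aemeasurable]
    simp only [hNalaw]
    exact hNlaw
  have hpow : ∀ m ≤ 4, Integrable (fun t : ℝ => t ^ m) 𝒟 := by
    intro m hm
    rw [← integrable_norm_iff (by fun_prop)]
    simp only [norm_pow]
    exact integrable_norm_pow_of_le (by fun_prop) hm (by simpa only [norm_pow] using hm₄_int.norm)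
  have hNpow (a : Fin k ⊕ Fin k) : ∀ m ≤ 4, Integrable (fun ω => N ω a ^ m) Pr := by
    intro m hm
    have hint := hpow m hm
    rw [← hNalaw a] at hint
    exact hint.comp_measurable (hNi a)
  have hNmom (a : Fin k ⊕ Fin k) (m : ℕ) : ∫ ω, N ω a ^ m ∂Pr = ∫ t, t ^ m ∂𝒟 := by
    rw [← hNalaw a, integral_map (hNi a).aemeasurable (by fun_prop)]
  have hmom (i : Fin k) : ∀ n ≤ 4,
      Integrable (fun ω => (N ω (Sum.inl i) - N ω (Sum.inr i)) ^ n) Pr ∧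
        ∫ ω, (N ω (Sum.inl i) - N ω (Sum.inr i)) ^ n ∂Pr
          = ∑ m ∈ range (n + 1),
            (-1) ^ (m + n) * ((∫ t, t ^ m ∂𝒟) * ∫ t, t ^ (n - m) ∂𝒟) * n.choose m := by
    intro n hn
    have h := (hNind.indepFun (i := Sum.inl i) (j := Sum.inr i) (by simp)).integral_sub_pow
      (n := n) (fun m hm => hNpow _ m (hm.trans hn)) (fun m hm => hNpow _ m (hm.trans hn))
    simpa only [hNmom] using h
  have hVmeas (i : Fin k) : Measurable fun ω => ∑ j, S ω i j * (x j - y j) :=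
    (show Measurable fun M : Fin k → Fin d → ℝ => ∑ j, M i j * (x j - y j) by
      fun_prop).comp hSmeas
  have hA : MemLp (fun ω => ∑ i, (∑ j, S ω i j * (x j - y j)) ^ 2) 2 Pr := by
    rw [memLp_two_iff_integrable_sq]
    · exact hS4int
    · exact (Finset.measurable_sum _ fun i _ => (hVmeas i).pow_const 2).aestronglyMeasurable
  have key := variance_sum_add_sq (P := Pr)
    (V := fun ω i => ∑ j, S ω i j * (x j - y j))
    (W := fun ω i => N ω (Sum.inl i) - N ω (Sum.inr i))
    (s := 2 * m₂) (q := 2 * m₄ + 6 * m₂ ^ 2)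
    (measurable_pi_iff.2 hVmeas)
    (measurable_pi_iff.2 fun i => (hNi _).sub (hNi _))
    (hindep.comp (φ := fun M i => ∑ j, M i j * (x j - y j))
      (ψ := fun n i => n (Sum.inl i) - n (Sum.inr i)) (by fun_prop) (by fun_prop))
    (fun i j hij => IndepFun.comp (φ := fun p : ℝ × ℝ => p.1 - p.2)
      (ψ := fun p : ℝ × ℝ => p.1 - p.2) (hNind.indepFun_prodMk_prodMk hNi (Sum.inl i) (Sum.inr i) (Sum.inl j)
      (Sum.inr j) (by simpa) (by simp) (by simp) (by simpa))
      (by fun_prop) (by fun_prop))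
    (fun i => hA.mono ((hVmeas i).pow_const 2).aestronglyMeasurable (.of_forall fun ω => by
      rw [Real.norm_of_nonneg (sq_nonneg _),
        Real.norm_of_nonneg (Finset.sum_nonneg fun i _ => sq_nonneg _)]
      exact Finset.single_le_sum (f := fun i => (∑ j, S ω i j * (x j - y j)) ^ 2)
        (fun i _ => sq_nonneg _) (Finset.mem_univ i)))
    (fun i => by
      refine (memLp_two_iff_integrable_sq
        (((hNi _).sub (hNi _)).pow_const 2).aestronglyMeasurable).2 ?_
      simpa only [Pi.sub_apply, ← pow_mul] using (hmom i 4 le_rfl).1)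
    (fun i => by
      have h := (hmom i 1 (by norm_num)).2
      simpa [Finset.sum_range_succ, hmean] using h)
    (fun i => by
      rw [(hmom i 2 (by norm_num)).2]
      simp [Finset.sum_range_succ, hmean, ← hm₂]
      ring)
    (fun i => by
      rw [(hmom i 3 (by norm_num)).2]
      simp [Finset.sum_range_succ, hmean]
      ring)
    (fun i => by
      rw [(hmom i 4 le_rfl).2]
      simp [Finset.sum_range_succ, hmean, ← hm₂, ← hm₄, Nat.choose]
      ring)
  rw [hLPP (fun j => x j - y j)] at key
  have hrw (ω : Ω) (i : Fin k) : (∑ j, S ω i j * x j) + N ω (Sum.inl i)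
      - ((∑ j, S ω i j * y j) + N ω (Sum.inr i))
      = (∑ j, S ω i j * (x j - y j)) + (N ω (Sum.inl i) - N ω (Sum.inr i)) := by
    simp only [mul_sub, Finset.sum_sub_distrib]
    ring
  simp only [hrw]
  rw [variance_sub_const, key, Fintype.card_fin]
  · ring
  · exact (Finset.measurable_sum _ fun i _ => ((hVmeas i).add
      ((hNi _).sub (hNi _))).pow_const 2).aestronglyMeasurable
end

section
/- Let S be a random k×d real matrix satisfying the Length Preserving Property, let x, y ∈ ℝ^d be fixed vectors, and let η, μ be noise vectors as in the context with m₂, m₄ < ∞ and with E[‖S(x−y)‖₂⁴] finite. Then E[‖(Sx+η) − (Sy+μ)‖₂⁴] = E[‖S(x−y)‖₂⁴] + 4(k+2)·m₂·‖x−y‖₂² + 2k·m₄ + 2k(1+2k)·m₂². -/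
open MeasureTheory ProbabilityTheory Finset
open scoped ENNReal NNReal

section SingleVariable

variable {𝒟 : Measure ℝ}

lemma integrable_cube_of_integrable_sq_of_integrable_pow_four
    (h2 : Integrable (fun t => t ^ 2) 𝒟) (h4 : Integrable (fun t => t ^ 4) 𝒟) :
    Integrable (fun t => t ^ 3) 𝒟 := by
  refine (h2.add h4).mono' (by fun_prop) (ae_of_all _ fun t => ?_)
  simp only [Pi.add_apply, Real.norm_eq_abs]
  exact abs_le.2 ⟨by nlinarith [sq_nonneg (t * (t + 1))], by nlinarith [sq_nonneg (t * (t - 1))]⟩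

/-- The expectation of a quartic polynomial of a centred variable. -/
lemma integral_quartic [IsProbabilityMeasure 𝒟]
    (h1 : Integrable (fun t => t) 𝒟) (hmean : (∫ t, t ∂𝒟) = 0)
    (h2 : Integrable (fun t => t ^ 2) 𝒟) (h4 : Integrable (fun t => t ^ 4) 𝒟)
    (a b c d e : ℝ) :
    (∫ t, (a * t ^ 4 + b * t ^ 3 + c * t ^ 2 + d * t + e) ∂𝒟)
      = a * (∫ t, t ^ 4 ∂𝒟) + b * (∫ t, t ^ 3 ∂𝒟) + c * (∫ t, t ^ 2 ∂𝒟) + e := by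
  have h3 := integrable_cube_of_integrable_sq_of_integrable_pow_four h2 h4
  have i4 := h4.const_mul a
  have i3 := h3.const_mul b
  have i2 := h2.const_mul c
  have i1 := h1.const_mul d
  rw [integral_add (((i4.fun_add i3).fun_add i2).fun_add i1) (integrable_const e),
    integral_add ((i4.fun_add i3).fun_add i2) i1, integral_add (i4.fun_add i3) i2,
    integral_add i4 i3, integral_const_mul d fun t => t, hmean]
  simp only [integral_const_mul, mul_zero, add_zero, integral_const, probReal_univ,
    one_smul]

end SingleVariable

section Pair

variable {𝒟 : Measure ℝ} [IsProbabilityMeasure 𝒟]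

lemma integrable_shifted_sub_pow_four (h4 : Integrable (fun t => t ^ 4) 𝒟) (z : ℝ) :
    Integrable (fun p : ℝ × ℝ => (z + p.1 - p.2) ^ 4) (𝒟.prod 𝒟) := by
  refine ((((integrable_const (z ^ 4)).add (h4.comp_fst 𝒟)).add (h4.comp_snd 𝒟)).const_mul
    27).mono' (by fun_prop) (ae_of_all _ fun p => ?_)
  obtain ⟨s, t⟩ := p
  simp only [Pi.add_apply, Real.norm_eq_abs]
  rw [abs_of_nonneg (by positivity)]
  have hsq : (z + s - t) ^ 2 ≤ 3 * (z ^ 2 + s ^ 2 + t ^ 2) := by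
    nlinarith [sq_nonneg (z - s), sq_nonneg (z + t), sq_nonneg (s + t)]
  have hpow := pow_le_pow_left₀ (sq_nonneg _) hsq 2
  nlinarith [sq_nonneg (z ^ 2 - s ^ 2), sq_nonneg (z ^ 2 - t ^ 2), sq_nonneg (s ^ 2 - t ^ 2)]

lemma integrable_shifted_sub_sq (h4 : Integrable (fun t => t ^ 4) 𝒟) (z : ℝ) :
    Integrable (fun p : ℝ × ℝ => (z + p.1 - p.2) ^ 2) (𝒟.prod 𝒟) := by
  refine ((integrable_const 1).add (integrable_shifted_sub_pow_four h4 z)).mono' (by fun_prop)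
    (ae_of_all _ fun p => ?_)
  simp only [Pi.add_apply, Real.norm_eq_abs]
  rw [abs_of_nonneg (by positivity)]
  nlinarith [sq_nonneg ((z + p.1 - p.2) ^ 2 - 1)]

lemma integral_shifted_sub_pow_four
    (h1 : Integrable (fun t => t) 𝒟) (hmean : (∫ t, t ∂𝒟) = 0)
    (h2 : Integrable (fun t => t ^ 2) 𝒟) (h4 : Integrable (fun t => t ^ 4) 𝒟) (z : ℝ) :
    (∫ p : ℝ × ℝ, (z + p.1 - p.2) ^ 4 ∂(𝒟.prod 𝒟))
      = z ^ 4 + 12 * z ^ 2 * (∫ t, t ^ 2 ∂𝒟) + 2 * (∫ t, t ^ 4 ∂𝒟)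
        + 6 * (∫ t, t ^ 2 ∂𝒟) ^ 2 := by
  have inner (s : ℝ) : (∫ t, (z + s - t) ^ 4 ∂𝒟)
      = 1 * s ^ 4 + (4 * z) * s ^ 3 + (6 * z ^ 2 + 6 * ∫ t, t ^ 2 ∂𝒟) * s ^ 2
        + (4 * z ^ 3 + 12 * z * (∫ t, t ^ 2 ∂𝒟) - 4 * ∫ t, t ^ 3 ∂𝒟) * s
        + (z ^ 4 + 6 * z ^ 2 * (∫ t, t ^ 2 ∂𝒟) - 4 * z * (∫ t, t ^ 3 ∂𝒟)
          + ∫ t, t ^ 4 ∂𝒟) := by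
    have h := integral_quartic h1 hmean h2 h4 1 (-4 * (z + s)) (6 * (z + s) ^ 2)
      (-4 * (z + s) ^ 3) ((z + s) ^ 4)
    rw [show (fun t : ℝ => (z + s - t) ^ 4) = fun t => 1 * t ^ 4 + (-4 * (z + s)) * t ^ 3
      + (6 * (z + s) ^ 2) * t ^ 2 + (-4 * (z + s) ^ 3) * t + (z + s) ^ 4 by ext t; ring, h]
    ring
  rw [integral_prod _ (integrable_shifted_sub_pow_four h4 z)]
  simp only [inner]
  rw [integral_quartic h1 hmean h2 h4]
  ring

lemma integral_shifted_sub_sq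
    (h1 : Integrable (fun t => t) 𝒟) (hmean : (∫ t, t ∂𝒟) = 0)
    (h2 : Integrable (fun t => t ^ 2) 𝒟) (h4 : Integrable (fun t => t ^ 4) 𝒟) (z : ℝ) :
    (∫ p : ℝ × ℝ, (z + p.1 - p.2) ^ 2 ∂(𝒟.prod 𝒟)) = z ^ 2 + 2 * (∫ t, t ^ 2 ∂𝒟) := by
  have inner (s : ℝ) : (∫ t, (z + s - t) ^ 2 ∂𝒟)
      = 0 * s ^ 4 + 0 * s ^ 3 + 1 * s ^ 2 + (2 * z) * s + (z ^ 2 + ∫ t, t ^ 2 ∂𝒟) := by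
    have h := integral_quartic h1 hmean h2 h4 0 0 1 (-2 * (z + s)) ((z + s) ^ 2)
    rw [show (fun t : ℝ => (z + s - t) ^ 2) = fun t => 0 * t ^ 4 + 0 * t ^ 3
      + 1 * t ^ 2 + (-2 * (z + s)) * t + (z + s) ^ 2 by ext t; ring, h]
    ring
  rw [integral_prod _ (integrable_shifted_sub_sq h4 z)]
  simp only [inner]
  rw [integral_quartic h1 hmean h2 h4]
  ring

lemma measurePreserving_eval_pair {ι : Type*} [Fintype ι] {p q : ι} (hpq : p ≠ q) :
    MeasurePreserving (fun n : ι → ℝ => (n p, n q)) (Measure.pi fun _ => 𝒟) (𝒟.prod 𝒟) := by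
  refine ⟨by fun_prop, ?_⟩
  have hind := (iIndepFun_pi (μ := fun _ : ι => 𝒟) (X := fun _ => id)
    fun _ => aemeasurable_id).indepFun hpq
  simp only [id] at hind
  have h := hind.map_prod_eq_prod_map_map (measurable_pi_apply p).aemeasurable
    (measurable_pi_apply q).aemeasurable
  rw [h]
  congr 1
  · exact (measurePreserving_eval (fun _ : ι => 𝒟) p).map_eq
  · exact (measurePreserving_eval (fun _ : ι => 𝒟) q).map_eq

end Pair

section Vector

variable {𝒟 : Measure ℝ} [IsProbabilityMeasure 𝒟] {k : ℕ}

lemma integrable_noise_sq_mul_sq (h4 : Integrable (fun t => t ^ 4) 𝒟) (z : Fin k → ℝ)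
    (i j : Fin k) :
    Integrable (fun n : Fin k ⊕ Fin k → ℝ => (z i + n (.inl i) - n (.inr i)) ^ 2
      * (z j + n (.inl j) - n (.inr j)) ^ 2) (Measure.pi fun _ => 𝒟) := by
  have h (i : Fin k) : Integrable (fun n : Fin k ⊕ Fin k → ℝ =>
      (z i + n (.inl i) - n (.inr i)) ^ 4) (Measure.pi fun _ => 𝒟) :=
    (measurePreserving_eval_pair Sum.inl_ne_inr).integrable_comp_of_integrable
      (integrable_shifted_sub_pow_four h4 (z i))
  refine ((h i).add (h j)).mono' (by fun_prop) (ae_of_all _ fun n => ?_)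
  simp only [Pi.add_apply, Real.norm_eq_abs]
  rw [abs_of_nonneg (by positivity)]
  set a := z i + n (.inl i) - n (.inr i)
  set b := z j + n (.inl j) - n (.inr j)
  nlinarith [sq_nonneg (a ^ 2 - b ^ 2), sq_nonneg (a ^ 2 + b ^ 2)]

lemma integrable_noise_norm_pow_four (h4 : Integrable (fun t => t ^ 4) 𝒟) (z : Fin k → ℝ) :
    Integrable (fun n : Fin k ⊕ Fin k → ℝ => (∑ i, (z i + n (.inl i) - n (.inr i)) ^ 2) ^ 2)
      (Measure.pi fun _ => 𝒟) := by
  simp only [sq (∑ i, _), sum_mul_sum]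
  exact integrable_finsetSum _ fun i _ => integrable_finsetSum _ fun j _ =>
    integrable_noise_sq_mul_sq h4 z i j

lemma integral_noise_sq
    (h1 : Integrable (fun t => t) 𝒟) (hmean : (∫ t, t ∂𝒟) = 0)
    (h2 : Integrable (fun t => t ^ 2) 𝒟) (h4 : Integrable (fun t => t ^ 4) 𝒟)
    (z : Fin k → ℝ) (i : Fin k) :
    (∫ n : Fin k ⊕ Fin k → ℝ, (z i + n (.inl i) - n (.inr i)) ^ 2 ∂(Measure.pi fun _ => 𝒟))
      = z i ^ 2 + 2 * (∫ t, t ^ 2 ∂𝒟) := by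
  have hp := measurePreserving_eval_pair (𝒟 := 𝒟) (Sum.inl_ne_inr (a := i) (b := i))
  rw [← integral_shifted_sub_sq h1 hmean h2 h4 (z i), ← hp.map_eq,
    integral_map hp.measurable.aemeasurable (by fun_prop)]

lemma integral_noise_sq_mul_sq
    (h1 : Integrable (fun t => t) 𝒟) (hmean : (∫ t, t ∂𝒟) = 0)
    (h2 : Integrable (fun t => t ^ 2) 𝒟) (h4 : Integrable (fun t => t ^ 4) 𝒟)
    (z : Fin k → ℝ) (i j : Fin k) :
    (∫ n : Fin k ⊕ Fin k → ℝ, (z i + n (.inl i) - n (.inr i)) ^ 2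
        * (z j + n (.inl j) - n (.inr j)) ^ 2 ∂(Measure.pi fun _ => 𝒟))
      = (z i ^ 2 + 2 * (∫ t, t ^ 2 ∂𝒟)) * (z j ^ 2 + 2 * (∫ t, t ^ 2 ∂𝒟))
        + if i = j then 8 * (∫ t, t ^ 2 ∂𝒟) * z i ^ 2 + 2 * (∫ t, t ^ 4 ∂𝒟)
          + 2 * (∫ t, t ^ 2 ∂𝒟) ^ 2 else 0 := by
  rcases eq_or_ne i j with rfl | hij
  · have hp := measurePreserving_eval_pair (𝒟 := 𝒟) (Sum.inl_ne_inr (a := i) (b := i))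
    have h := integral_shifted_sub_pow_four h1 hmean h2 h4 (z i)
    rw [← hp.map_eq, integral_map hp.measurable.aemeasurable (by fun_prop)] at h
    simp only [← pow_add, Nat.reduceAdd, if_true]
    rw [h]
    ring
  · have hind := (iIndepFun_pi (μ := fun _ : Fin k ⊕ Fin k => 𝒟) (X := fun _ => id)
      fun _ => aemeasurable_id).indepFun_prodMk_prodMk (fun _ => by fun_prop)
      (.inl i) (.inr i) (.inl j) (.inr j) (by simpa using hij) (by simp) (by simp)
      (by simpa using hij)
    have hind' := hind.comp (φ := fun p : ℝ × ℝ => (z i + p.1 - p.2) ^ 2)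
      (ψ := fun p : ℝ × ℝ => (z j + p.1 - p.2) ^ 2) (by fun_prop) (by fun_prop)
    simp only [Function.comp_def, id] at hind'
    rw [hind'.integral_fun_mul_eq_mul_integral (by fun_prop) (by fun_prop),
      integral_noise_sq h1 hmean h2 h4, integral_noise_sq h1 hmean h2 h4, if_neg hij, add_zero]

lemma integral_noise_norm_pow_four
    (h1 : Integrable (fun t => t) 𝒟) (hmean : (∫ t, t ∂𝒟) = 0)
    (h2 : Integrable (fun t => t ^ 2) 𝒟) (h4 : Integrable (fun t => t ^ 4) 𝒟)
    (z : Fin k → ℝ) :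
    (∫ n : Fin k ⊕ Fin k → ℝ, (∑ i, (z i + n (.inl i) - n (.inr i)) ^ 2) ^ 2
        ∂(Measure.pi fun _ => 𝒟))
      = (∑ i, z i ^ 2) ^ 2 + 4 * ((k : ℝ) + 2) * (∫ t, t ^ 2 ∂𝒟) * (∑ i, z i ^ 2)
        + (2 * (k : ℝ) * (∫ t, t ^ 4 ∂𝒟)
          + 2 * (k : ℝ) * (1 + 2 * (k : ℝ)) * (∫ t, t ^ 2 ∂𝒟) ^ 2) := by
  have hsum (i : Fin k) := integral_finsetSum univ fun j _ =>
    integrable_noise_sq_mul_sq h4 z i j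
  simp only [sq (∑ i, (z i + _ - _) ^ 2), sum_mul_sum]
  rw [integral_finsetSum _ fun i _ => integrable_finsetSum _ fun j _ =>
    integrable_noise_sq_mul_sq h4 z i j]
  simp only [hsum, integral_noise_sq_mul_sq h1 hmean h2 h4, sum_add_distrib, sum_ite_eq,
    mem_univ, if_true]
  simp only [← mul_sum, ← sum_mul, sum_add_distrib, sum_const, card_univ, Fintype.card_fin,
    nsmul_eq_mul]
  ring

/-- The squared form of `‖z + v‖² ≤ 2‖z‖² + 2‖v‖²`. -/
lemma sq_sum_add_sq_le {ι : Type*} (s : Finset ι) (z v : ι → ℝ) :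
    (∑ i ∈ s, (z i + v i) ^ 2) ^ 2
      ≤ 8 * ((∑ i ∈ s, z i ^ 2) ^ 2 + (∑ i ∈ s, v i ^ 2) ^ 2) := by
  have hle : ∑ i ∈ s, (z i + v i) ^ 2 ≤ 2 * (∑ i ∈ s, z i ^ 2 + ∑ i ∈ s, v i ^ 2) := by
    rw [← sum_add_distrib, mul_sum]
    exact sum_le_sum fun i _ => add_sq_le
  have hpow := pow_le_pow_left₀ (sum_nonneg fun i _ => sq_nonneg (z i + v i)) hle 2
  nlinarith [sq_nonneg (∑ i ∈ s, z i ^ 2 - ∑ i ∈ s, v i ^ 2)]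

lemma integrable_prod_noise_norm_pow_four (h4 : Integrable (fun t => t ^ 4) 𝒟)
    {ν : Measure (Fin k → ℝ)} [IsFiniteMeasure ν]
    (hν : Integrable (fun z : Fin k → ℝ => (∑ i, z i ^ 2) ^ 2) ν) :
    Integrable (fun p : (Fin k → ℝ) × (Fin k ⊕ Fin k → ℝ) =>
        (∑ i, (p.1 i + p.2 (.inl i) - p.2 (.inr i)) ^ 2) ^ 2)
      (ν.prod (Measure.pi fun _ => 𝒟)) := by
  have hn := integrable_noise_norm_pow_four (k := k) h4 0
  refine (((hν.comp_fst (Measure.pi fun _ => 𝒟)).add (hn.comp_snd ν)).const_mul 8).mono'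
    (by fun_prop) (ae_of_all _ fun p => ?_)
  simp only [Pi.add_apply, Pi.zero_apply, zero_add, Real.norm_eq_abs]
  rw [abs_of_nonneg (by positivity)]
  simpa only [add_sub_assoc] using
    sq_sum_add_sq_le univ p.1 (fun i => p.2 (.inl i) - p.2 (.inr i))

end Vector

/-- For a random `k × d` matrix `S` satisfying the Length Preserving
Property, fixed vectors `x y : ℝ^d`, and noise `η = N ∘ Sum.inl`, `μ = N ∘ Sum.inr`
whose `2k` coordinates are i.i.d. samples of a mean-zero distribution `𝒟` with finite
second and fourth moments `m₂, m₄`, independent of `S`, and with `E[‖S(x-y)‖₂⁴]` finite,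
`E[‖(Sx+η) - (Sy+μ)‖₂⁴] = E[‖S(x-y)‖₂⁴] + 4(k+2) m₂ ‖x-y‖₂² + 2 k m₄ + 2k(1+2k) m₂²`. -/
theorem fourth_moment_general_estimator
    {Ω : Type*} [MeasurableSpace Ω] (Pr : Measure Ω) [IsProbabilityMeasure Pr]
    (k d : ℕ)
    (S : Ω → Fin k → Fin d → ℝ) (hSmeas : Measurable S)
    (hLPP : ∀ z : Fin d → ℝ,
      (∫ ω, ∑ i, (∑ j, S ω i j * z j) ^ 2 ∂Pr) = ∑ j, (z j) ^ 2)
    (𝒟 : Measure ℝ) [IsProbabilityMeasure 𝒟]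
    (hmean_int : Integrable (fun t => t) 𝒟)
    (hmean : (∫ t, t ∂𝒟) = 0)
    (hm₂_int : Integrable (fun t => t ^ 2) 𝒟)
    (hm₄_int : Integrable (fun t => t ^ 4) 𝒟)
    (m₂ m₄ : ℝ) (hm₂ : m₂ = ∫ t, t ^ 2 ∂𝒟) (hm₄ : m₄ = ∫ t, t ^ 4 ∂𝒟)
    (N : Ω → (Fin k ⊕ Fin k) → ℝ) (hNmeas : Measurable N)
    (hNlaw : Measure.map N Pr = Measure.pi (fun _ => 𝒟))
    (hindep : IndepFun S N Pr)
    (x y : Fin d → ℝ)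
    (hS4int : Integrable
      (fun ω => (∑ i, (∑ j, S ω i j * (x j - y j)) ^ 2) ^ 2) Pr) :
    (∫ ω, (∑ i, ((∑ j, S ω i j * x j) + N ω (Sum.inl i)
          - ((∑ j, S ω i j * y j) + N ω (Sum.inr i))) ^ 2) ^ 2 ∂Pr)
      = (∫ ω, (∑ i, (∑ j, S ω i j * (x j - y j)) ^ 2) ^ 2 ∂Pr)
        + 4 * ((k : ℝ) + 2) * m₂ * (∑ j, (x j - y j) ^ 2)
        + 2 * (k : ℝ) * m₄
        + 2 * (k : ℝ) * (1 + 2 * (k : ℝ)) * m₂ ^ 2 := by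
  set Z : Ω → Fin k → ℝ := fun ω i => ∑ j, S ω i j * (x j - y j) with hZ
  have hφ : Measurable fun (A : Fin k → Fin d → ℝ) (i : Fin k) => ∑ j, A i j * (x j - y j) := by
    fun_prop
  have hZmeas : Measurable Z := hφ.comp hSmeas
  have hZN : IndepFun Z N Pr := hindep.comp hφ measurable_id
  have hlaw : Pr.map (fun ω => (Z ω, N ω)) = (Pr.map Z).prod (Measure.pi fun _ => 𝒟) := by
    rw [hZN.map_prod_eq_prod_map_map hZmeas.aemeasurable hNmeas.aemeasurable, hNlaw]
  have hZprob : IsProbabilityMeasure (Pr.map Z) := Measure.isProbabilityMeasure_map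
    hZmeas.aemeasurable
  have hν : Integrable (fun z : Fin k → ℝ => (∑ i, z i ^ 2) ^ 2) (Pr.map Z) :=
    (integrable_map_measure (Measurable.aestronglyMeasurable (by fun_prop)) hZmeas.aemeasurable).2 hS4int
  have hZsq : (∫ ω, ∑ i, Z ω i ^ 2 ∂Pr) = ∑ j, (x j - y j) ^ 2 := hLPP fun j => x j - y j
  have hZ4 : Integrable (fun ω => (∑ i, Z ω i ^ 2) ^ 2) Pr := hS4int
  have hsq : Integrable (fun ω => ∑ i, Z ω i ^ 2) Pr := by
    refine ((integrable_const 1).add hS4int).mono' (by fun_prop) (ae_of_all _ fun ω => ?_)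
    simp only [Pi.add_apply, Real.norm_eq_abs]
    rw [abs_of_nonneg (sum_nonneg fun i _ => sq_nonneg _)]
    nlinarith [sq_nonneg (∑ i, Z ω i ^ 2 - 1)]
  have hrw (ω : Ω) (i : Fin k) : (∑ j, S ω i j * x j) + N ω (Sum.inl i)
      - ((∑ j, S ω i j * y j) + N ω (Sum.inr i))
      = Z ω i + N ω (Sum.inl i) - N ω (Sum.inr i) := by
    simp only [hZ, mul_sub, sum_sub_distrib]
    ring
  simp only [hrw]
  rw [← integral_map (φ := fun ω => (Z ω, N ω)) (hZmeas.prodMk hNmeas).aemeasurable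
      (f := fun p : (Fin k → ℝ) × (Fin k ⊕ Fin k → ℝ) =>
        (∑ i, (p.1 i + p.2 (.inl i) - p.2 (.inr i)) ^ 2) ^ 2) (by fun_prop),
    hlaw, integral_prod _ (integrable_prod_noise_norm_pow_four hm₄_int hν)]
  simp only [integral_noise_norm_pow_four hmean_int hmean hm₂_int hm₄_int]
  rw [integral_map hZmeas.aemeasurable (by fun_prop),
    integral_add (hZ4.fun_add (hsq.const_mul _)) (integrable_const _),
    integral_add hZ4 (hsq.const_mul _), integral_const_mul, hZsq,
    integral_const, ← hm₂, ← hm₄]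
  simp only [probReal_univ, one_smul]
  ring
end

section
/- Let S be a random k×d real matrix satisfying the Length Preserving Property with E[‖S(x−y)‖₂⁴] finite, let x, y ∈ ℝ^d be fixed, let b > 0, and let η, μ ∈ ℝ^k have their 2k coordinates i.i.d. distributed as Lap(b), independently of S. Then the estimator Ê := ‖(Sx+η) − (Sy+μ)‖₂² − 4k·b² satisfies E[Ê] = ‖x−y‖₂² and Var[Ê] = Var[‖S(x−y)‖₂²] + 16·b²·‖x−y‖₂² + 56·k·b⁴. -/
open MeasureTheory ProbabilityTheory Finset
open scoped ENNReal NNReal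

/-- The centered Laplace distribution on `ℝ` with scale `b`, given by the density
`t ↦ (2b)⁻¹ * exp (-|t|/b)` with respect to Lebesgue measure. -/
noncomputable def laplaceMeasure (b : ℝ) : Measure ℝ :=
  MeasureTheory.volume.withDensity fun t => ENNReal.ofReal ((2 * b)⁻¹ * Real.exp (-|t| / b))

instance (b : ℝ) : SigmaFinite (laplaceMeasure b) :=
  SigmaFinite.withDensity_ofReal _

/-- The absolute moments of the Laplace distribution. -/
lemma integral_abs_pow_laplaceMeasure {b : ℝ} (hb : 0 < b) (n : ℕ) :
    ∫ t, |t| ^ n ∂(laplaceMeasure b) = n.factorial * b ^ n := by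
  have hmeas : Measurable fun t : ℝ => ENNReal.ofReal ((2 * b)⁻¹ * Real.exp (-|t| / b)) := by
    fun_prop
  rw [laplaceMeasure, integral_withDensity_eq_integral_toReal_smul hmeas
    (Filter.Eventually.of_forall fun _ => ENNReal.ofReal_lt_top)]
  have hpos (t : ℝ) : 0 ≤ (2 * b)⁻¹ * Real.exp (-|t| / b) := by positivity
  simp only [ENNReal.toReal_ofReal (hpos _), smul_eq_mul]
  rw [integral_comp_abs (f := fun t => (2 * b)⁻¹ * Real.exp (-t / b) * t ^ n)]
  have hint := Real.integral_rpow_mul_exp_neg_mul_Ioi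
    (a := n + 1) (by positivity) (inv_pos.mpr hb)
  have hcongr : ∀ t ∈ Set.Ioi (0 : ℝ), (2 * b)⁻¹ * Real.exp (-t / b) * t ^ n
      = (2 * b)⁻¹ * (t ^ ((n : ℝ) + 1 - 1) * Real.exp (-(b⁻¹ * t))) := by
    intro t _
    rw [add_sub_cancel_right, Real.rpow_natCast, neg_div, div_eq_inv_mul]
    ring
  rw [setIntegral_congr_fun measurableSet_Ioi hcongr, integral_const_mul, hint,
    Real.Gamma_nat_eq_factorial, one_div, inv_inv, ← Nat.cast_succ, Real.rpow_natCast, pow_succ]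
  field_simp

lemma integrable_pow_laplaceMeasure {b : ℝ} (hb : 0 < b) (n : ℕ) :
    Integrable (fun t => t ^ n) (laplaceMeasure b) := by
  have habs : Integrable (fun t : ℝ => |t| ^ n) (laplaceMeasure b) := by
    refine Integrable.of_integral_ne_zero ?_
    rw [integral_abs_pow_laplaceMeasure hb]
    positivity
  refine habs.mono' (by fun_prop) (Filter.Eventually.of_forall fun t => ?_)
  simp

lemma integral_pow_laplaceMeasure_of_even {b : ℝ} (hb : 0 < b) {n : ℕ} (hn : Even n) :
    ∫ t, t ^ n ∂(laplaceMeasure b) = n.factorial * b ^ n := by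
  simpa only [hn.pow_abs] using integral_abs_pow_laplaceMeasure hb n

lemma isProbabilityMeasure_laplaceMeasure {b : ℝ} (hb : 0 < b) :
    IsProbabilityMeasure (laplaceMeasure b) := by
  have h := integral_abs_pow_laplaceMeasure hb 0
  simp only [pow_zero, integral_const, smul_eq_mul, mul_one, Nat.factorial_zero,
    Nat.cast_one, Measure.real] at h
  exact ⟨(ENNReal.toReal_eq_one_iff _).mp h⟩

lemma integral_pow_laplaceMeasure_of_odd (b : ℝ) {n : ℕ} (hn : Odd n) :
    ∫ t, t ^ n ∂(laplaceMeasure b) = 0 := by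
  have hmeas : Measurable fun t : ℝ => ENNReal.ofReal ((2 * b)⁻¹ * Real.exp (-|t| / b)) := by
    fun_prop
  rw [laplaceMeasure, integral_withDensity_eq_integral_toReal_smul hmeas
    (Filter.Eventually.of_forall fun _ => ENNReal.ofReal_lt_top), ← self_eq_neg, ← integral_neg,
    ← integral_neg_eq_self]
  simp [hn.neg_pow]

section Difference

variable {Ω : Type*} [MeasurableSpace Ω] {P : Measure Ω} {X Y : Ω → ℝ} {b : ℝ}

lemma ProbabilityTheory.HasLaw.integral_pow {ν : Measure ℝ} (hX : HasLaw X ν P) (n : ℕ) :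
    ∫ ω, X ω ^ n ∂P = ∫ t, t ^ n ∂ν :=
  hX.integral_comp (f := fun t => t ^ n) (by fun_prop)

lemma ProbabilityTheory.HasLaw.integrable_pow_of_laplaceMeasure
    (hX : HasLaw X (laplaceMeasure b) P) (hb : 0 < b) (n : ℕ) :
    Integrable (fun ω => X ω ^ n) P := by
  have h := integrable_pow_laplaceMeasure hb n
  rw [← hX.map_eq] at h
  exact h.comp_aemeasurable hX.aemeasurable

lemma ProbabilityTheory.IndepFun.integrable_pow_mul_pow (hXY : IndepFun X Y P)
    {m n : ℕ} (hX : Integrable (fun ω => X ω ^ m) P) (hY : Integrable (fun ω => Y ω ^ n) P) :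
    Integrable (fun ω => X ω ^ m * Y ω ^ n) P :=
  (hXY.comp (measurable_id.pow_const m) (measurable_id.pow_const n)).integrable_mul hX hY

lemma ProbabilityTheory.IndepFun.integral_pow_mul_pow (hXY : IndepFun X Y P)
    (hX : AEMeasurable X P) (hY : AEMeasurable Y P) (m n : ℕ) :
    ∫ ω, X ω ^ m * Y ω ^ n ∂P = (∫ ω, X ω ^ m ∂P) * ∫ ω, Y ω ^ n ∂P :=
  (hXY.comp (measurable_id.pow_const m) (measurable_id.pow_const n)).integral_mul_eq_mul_integral
    (hX.pow_const m).aestronglyMeasurable (hY.pow_const n).aestronglyMeasurable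

/-- Binomial expansion of the moments of the difference of two independent variables having
Laplace distributions. -/
lemma integrable_and_integral_sub_pow_of_laplaceMeasure (hb : 0 < b) (hX : HasLaw X (laplaceMeasure b) P)
    (hY : HasLaw Y (laplaceMeasure b) P) (hXY : IndepFun X Y P) (n : ℕ) :
    Integrable (fun ω => (X ω - Y ω) ^ n) P ∧
    ∫ ω, (X ω - Y ω) ^ n ∂P = ∑ m ∈ range (n + 1), (-1) ^ (m + n) *
      (∫ t, t ^ m ∂(laplaceMeasure b)) * (∫ t, t ^ (n - m) ∂(laplaceMeasure b)) * n.choose m := by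
  have hint (m l : ℕ) : Integrable (fun ω => X ω ^ m * Y ω ^ l) P :=
    hXY.integrable_pow_mul_pow (hX.integrable_pow_of_laplaceMeasure hb m)
      (hY.integrable_pow_of_laplaceMeasure hb l)
  have hterm (m : ℕ) : Integrable
      (fun ω => (-1) ^ (m + n) * X ω ^ m * Y ω ^ (n - m) * (n.choose m : ℝ)) P := by
    simpa only [mul_assoc] using ((hint m (n - m)).mul_const (n.choose m : ℝ)).const_mul
      ((-1 : ℝ) ^ (m + n))
  simp only [sub_pow]
  refine ⟨integrable_finsetSum _ fun m _ => hterm m, ?_⟩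
  rw [integral_finsetSum _ fun m _ => hterm m]
  refine Finset.sum_congr rfl fun m _ => ?_
  simp only [mul_assoc ((-1 : ℝ) ^ (m + n))]
  rw [integral_const_mul, integral_mul_const,
    hXY.integral_pow_mul_pow hX.aemeasurable hY.aemeasurable, hX.integral_pow, hY.integral_pow]

end Difference

/-- Square integrability, mean and variance of `‖V + D‖²` when the random vector `V` is independent
of the noise vector `D`, whose coordinates are pairwise independent with vanishing first and third
moments, second moment `s` and fourth moment `q`. -/
theorem memLp_and_integral_and_variance_sum_sq_add_noise {Ω ι : Type*} [MeasurableSpace Ω] [Fintype ι]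
    {P : Measure Ω} [IsProbabilityMeasure P] {V D : Ω → ι → ℝ} {s q : ℝ}
    (hV : Measurable V) (hD : Measurable D) (hVD : IndepFun V D P)
    (hDD : Pairwise fun i j => IndepFun (fun ω => D ω i) (fun ω => D ω j) P)
    (hD4int : ∀ i, Integrable (fun ω => D ω i ^ 4) P)
    (hD1 : ∀ i, ∫ ω, D ω i ∂P = 0) (hD2 : ∀ i, ∫ ω, D ω i ^ 2 ∂P = s)
    (hD3 : ∀ i, ∫ ω, D ω i ^ 3 ∂P = 0) (hD4 : ∀ i, ∫ ω, D ω i ^ 4 ∂P = q)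
    (hV4 : Integrable (fun ω => (∑ i, V ω i ^ 2) ^ 2) P) :
    MemLp (fun ω => ∑ i, (V ω i + D ω i) ^ 2) 2 P ∧
    ∫ ω, ∑ i, (V ω i + D ω i) ^ 2 ∂P = ∫ ω, ∑ i, V ω i ^ 2 ∂P + Fintype.card ι * s ∧
    Var[fun ω => ∑ i, (V ω i + D ω i) ^ 2; P] = Var[fun ω => ∑ i, V ω i ^ 2; P]
      + 4 * s * ∫ ω, ∑ i, V ω i ^ 2 ∂P + Fintype.card ι * (q - s ^ 2) := by
  have hVm (i : ι) : Measurable fun ω => V ω i := by fun_prop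
  have hDm (i : ι) : Measurable fun ω => D ω i := by fun_prop
  have hprod {f g : (ι → ℝ) → ℝ} (hf : Measurable f) (hg : Measurable g) :
      ∫ ω, f (V ω) * g (D ω) ∂P = (∫ ω, f (V ω) ∂P) * ∫ ω, g (D ω) ∂P :=
    (hVD.comp hf hg).integral_mul_eq_mul_integral
      (hf.comp hV).aestronglyMeasurable (hg.comp hD).aestronglyMeasurable
  have hA : MemLp (fun ω => ∑ i, V ω i ^ 2) 2 P :=
    (memLp_two_iff_integrable_sq (by fun_prop)).mpr hV4
  have hV2int (i : ι) : Integrable (fun ω => V ω i ^ 2) P := by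
    refine (hA.integrable one_le_two).mono' (by fun_prop)
      (Filter.Eventually.of_forall fun ω => ?_)
    rw [Real.norm_of_nonneg (sq_nonneg _)]
    exact single_le_sum (f := fun i => V ω i ^ 2) (fun j _ => sq_nonneg _) (mem_univ i)
  have hDsq (i : ι) : MemLp (fun ω => D ω i ^ 2) 2 P := by
    refine (memLp_two_iff_integrable_sq (by fun_prop)).mpr ?_
    simpa only [← pow_mul] using hD4int i
  have hC : MemLp (fun ω => ∑ i, D ω i ^ 2) 2 P := memLp_finsetSum _ fun i _ => hDsq i
  have hcross (i : ι) : MemLp (fun ω => V ω i * D ω i) 2 P := by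
    refine (memLp_two_iff_integrable_sq (by fun_prop)).mpr ?_
    simp only [mul_pow]
    exact (hVD.comp (φ := fun v : ι → ℝ => v i ^ 2) (ψ := fun v : ι → ℝ => v i ^ 2)
      (by fun_prop) (by fun_prop)).integrable_mul (hV2int i)
      ((hDsq i).integrable one_le_two)
  have hB : MemLp (fun ω => ∑ i, V ω i * D ω i) 2 P := memLp_finsetSum _ fun i _ => hcross i
  have hcross_mean (i : ι) : ∫ ω, V ω i * D ω i ∂P = 0 := by
    rw [hprod (f := fun v => v i) (g := fun v => v i) (by fun_prop) (by fun_prop), hD1, mul_zero]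
  have hB_mean : ∫ ω, ∑ i, V ω i * D ω i ∂P = 0 := by
    rw [integral_finsetSum _ fun i _ => (hcross i).integrable one_le_two]
    simp [hcross_mean]
  have hC_mean : ∫ ω, ∑ i, D ω i ^ 2 ∂P = Fintype.card ι * s := by
    rw [integral_finsetSum _ fun i _ => (hDsq i).integrable one_le_two]
    simp [hD2]
  have hexpand : (fun ω => ∑ i, (V ω i + D ω i) ^ 2) =
      fun ω => (∑ i, V ω i ^ 2 + 2 * ∑ i, V ω i * D ω i) + ∑ i, D ω i ^ 2 := by
    ext ω
    rw [mul_sum, ← sum_add_distrib, ← sum_add_distrib]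
    exact sum_congr rfl fun i _ => by ring
  have hcovAB : cov[fun ω => ∑ i, V ω i ^ 2, fun ω => ∑ i, V ω i * D ω i; P] = 0 := by
    rw [covariance_fun_sum_right hcross hA]
    refine sum_eq_zero fun i _ => ?_
    rw [covariance_eq_sub hA (hcross i), hcross_mean, mul_zero, sub_zero]
    simp only [Pi.mul_apply, ← mul_assoc]
    rw [hprod (f := fun v => (∑ j, v j ^ 2) * v i) (g := fun v => v i) (by fun_prop)
      (by fun_prop), hD1, mul_zero]
  have hcovAC : cov[fun ω => ∑ i, V ω i ^ 2, fun ω => ∑ i, D ω i ^ 2; P] = 0 :=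
    (hVD.comp (φ := fun v : ι → ℝ => ∑ i, v i ^ 2)
      (ψ := fun v : ι → ℝ => ∑ i, v i ^ 2)
      (by fun_prop) (by fun_prop)).covariance_eq_zero hA hC
  have hcovBC : cov[fun ω => ∑ i, V ω i * D ω i, fun ω => ∑ i, D ω i ^ 2; P] = 0 := by
    rw [covariance_fun_sum_fun_sum hcross hDsq]
    refine sum_eq_zero fun i _ => sum_eq_zero fun j _ => ?_
    rw [covariance_eq_sub (hcross i) (hDsq j), hcross_mean, zero_mul, sub_zero]
    simp only [Pi.mul_apply, mul_assoc]
    rw [hprod (f := fun v => v i) (g := fun v => v i * v j ^ 2) (by fun_prop) (by fun_prop)]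
    suffices h : ∫ ω, D ω i * D ω j ^ 2 ∂P = 0 by rw [h, mul_zero]
    rcases eq_or_ne i j with rfl | hij
    · simpa only [← pow_succ'] using hD3 i
    · have h := (hDD hij).integral_pow_mul_pow (hDm i).aemeasurable (hDm j).aemeasurable 1 2
      simpa only [pow_one, hD1, zero_mul] using h
  have hvarB : Var[fun ω => ∑ i, V ω i * D ω i; P] = s * ∫ ω, ∑ i, V ω i ^ 2 ∂P := by
    rw [variance_fun_sum hcross, integral_finsetSum _ fun i _ => hV2int i, mul_sum]
    refine sum_congr rfl fun i _ => ?_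
    have hcov (j : ι) : cov[fun ω => V ω i * D ω i, fun ω => V ω j * D ω j; P]
        = (∫ ω, V ω i * V ω j ∂P) * ∫ ω, D ω i * D ω j ∂P := by
      rw [covariance_eq_sub (hcross i) (hcross j), hcross_mean, zero_mul, sub_zero]
      simp only [Pi.mul_apply, mul_mul_mul_comm]
      exact hprod (f := fun v => v i * v j) (g := fun v => v i * v j) (by fun_prop) (by fun_prop)
    simp only [hcov]
    rw [sum_eq_single i]
    · simp only [← pow_two, hD2, mul_comm]
    · intro j _ hji
      have h := (hDD hji.symm).integral_pow_mul_pow (hDm i).aemeasurable (hDm j).aemeasurable 1 1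
      simp only [pow_one, hD1, zero_mul] at h
      rw [h, mul_zero]
    · simp
  have hvarC : Var[fun ω => ∑ i, D ω i ^ 2; P] = Fintype.card ι * (q - s ^ 2) := by
    have h := IndepFun.variance_sum (μ := P) (s := univ) (X := fun i ω => D ω i ^ 2)
      (fun i _ => hDsq i) fun i _ j _ hij =>
        (hDD hij).comp (measurable_id.pow_const 2) (measurable_id.pow_const 2)
    have hvar (i : ι) : Var[fun ω => D ω i ^ 2; P] = q - s ^ 2 := by
      rw [variance_eq_sub (hDsq i), hD2]
      simp only [Pi.pow_apply, ← pow_mul]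
      rw [← hD4 i]
    simp only [hvar, sum_const, card_univ, nsmul_eq_mul] at h
    rw [← h]
    congr 1
    ext ω
    simp
  have hB2 : MemLp (fun ω => 2 * ∑ i, V ω i * D ω i) 2 P := hB.const_mul 2
  have hAB : MemLp (fun ω => ∑ i, V ω i ^ 2 + 2 * ∑ i, V ω i * D ω i) 2 P := hA.add hB2
  have hcovABC : cov[fun ω => ∑ i, V ω i ^ 2 + 2 * ∑ i, V ω i * D ω i,
      fun ω => ∑ i, D ω i ^ 2; P] = 0 := by
    have h := covariance_add_left hA hB2 hC
    rw [covariance_const_mul_left, hcovAC, hcovBC, mul_zero, add_zero] at h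
    exact h
  rw [hexpand]
  refine ⟨hAB.add hC, ?_, ?_⟩
  · rw [integral_add (hAB.integrable one_le_two) (hC.integrable one_le_two),
      integral_add (hA.integrable one_le_two) (hB2.integrable one_le_two), integral_const_mul,
      hB_mean, hC_mean]
    ring
  · rw [variance_fun_add hAB hC, variance_fun_add hA hB2, covariance_const_mul_right,
      variance_const_mul, hcovABC, hcovAB, hvarB, hvarC]
    ring

/-- Let `S` be a random `k × d` matrix satisfying the Length Preserving
Property with `E[‖S(x-y)‖₂⁴]` finite, let `x, y ∈ ℝ^d` be fixed, let `b > 0`, and let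
`η = N ∘ Sum.inl`, `μ = N ∘ Sum.inr` have their `2k` coordinates i.i.d. `Lap(b)`,
independently of `S`.  Then `Ê = ‖(Sx+η) - (Sy+μ)‖₂² - 4 k b²` satisfies
`E[Ê] = ‖x-y‖₂²` and `Var[Ê] = Var[‖S(x-y)‖₂²] + 16 b² ‖x-y‖₂² + 56 k b⁴`. -/
theorem laplace_noise_estimator
    {Ω : Type*} [MeasurableSpace Ω] (Pr : Measure Ω) [IsProbabilityMeasure Pr]
    (k d : ℕ)
    (S : Ω → Fin k → Fin d → ℝ) (hSmeas : Measurable S)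
    (hLPP : ∀ z : Fin d → ℝ,
      (∫ ω, ∑ i, (∑ j, S ω i j * z j) ^ 2 ∂Pr) = ∑ j, (z j) ^ 2)
    (b : ℝ) (hb : 0 < b)
    (N : Ω → (Fin k ⊕ Fin k) → ℝ) (hNmeas : Measurable N)
    (hNlaw : Measure.map N Pr = Measure.pi (fun _ => laplaceMeasure b))
    (hindep : IndepFun S N Pr)
    (x y : Fin d → ℝ)
    (hS4int : Integrable
      (fun ω => (∑ i, (∑ j, S ω i j * (x j - y j)) ^ 2) ^ 2) Pr) :
    (∫ ω, (∑ i, ((∑ j, S ω i j * x j) + N ω (Sum.inl i)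
          - ((∑ j, S ω i j * y j) + N ω (Sum.inr i))) ^ 2)
        - 4 * (k : ℝ) * b ^ 2 ∂Pr) = ∑ j, (x j - y j) ^ 2
    ∧ variance (fun ω =>
        (∑ i, ((∑ j, S ω i j * x j) + N ω (Sum.inl i)
          - ((∑ j, S ω i j * y j) + N ω (Sum.inr i))) ^ 2)
        - 4 * (k : ℝ) * b ^ 2) Pr
      = variance (fun ω => ∑ i, (∑ j, S ω i j * (x j - y j)) ^ 2) Pr
        + 16 * b ^ 2 * (∑ j, (x j - y j) ^ 2)
        + 56 * (k : ℝ) * b ^ 4 := by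
  have := isProbabilityMeasure_laplaceMeasure hb
  have hNi (a : Fin k ⊕ Fin k) : Measurable fun ω => N ω a := by fun_prop
  have hlaw (a : Fin k ⊕ Fin k) : HasLaw (fun ω => N ω a) (laplaceMeasure b) Pr :=
    ⟨(hNi a).aemeasurable, by
      rw [← (measurePreserving_eval (fun _ : Fin k ⊕ Fin k => laplaceMeasure b) a).map_eq,
        ← hNlaw, Measure.map_map (measurable_pi_apply a) hNmeas]
      rfl⟩
  have hNindep : iIndepFun (fun a ω => N ω a) Pr := by
    rw [iIndepFun_iff_map_fun_eq_pi_map fun a => (hNi a).aemeasurable]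
    simpa only [(hlaw _).map_eq] using hNlaw
  have hmom (i : Fin k) := integrable_and_integral_sub_pow_of_laplaceMeasure hb
    (hlaw (Sum.inl i)) (hlaw (Sum.inr i)) (hNindep.indepFun Sum.inl_ne_inr)
  have hmean : ∫ t, t ∂(laplaceMeasure b) = 0 := by
    simpa only [pow_one] using integral_pow_laplaceMeasure_of_odd b odd_one
  have hthird := integral_pow_laplaceMeasure_of_odd b (n := 3) (by decide)
  have hsecond := integral_pow_laplaceMeasure_of_even hb (n := 2) (by decide)
  have hfourth := integral_pow_laplaceMeasure_of_even hb (n := 4) (by decide)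
  obtain ⟨hL2, hE, hVar⟩ := memLp_and_integral_and_variance_sum_sq_add_noise (P := Pr)
    (V := fun ω i => ∑ j, S ω i j * (x j - y j))
    (D := fun ω i => N ω (Sum.inl i) - N ω (Sum.inr i)) (s := 4 * b ^ 2) (q := 72 * b ^ 4)
    (by fun_prop) (by fun_prop)
    (hindep.comp (φ := fun M i => ∑ j, M i j * (x j - y j))
      (ψ := fun n i => n (Sum.inl i) - n (Sum.inr i)) (by fun_prop) (by fun_prop))
    (fun i j hij => hNindep.indepFun_sub_sub hNi _ _ _ _ (by simpa using hij) Sum.inl_ne_inr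
      Sum.inr_ne_inl (by simpa using hij))
    (fun i => (hmom i 4).1)
    (fun i => by
      have h := (hmom i 1).2
      simpa [sum_range_succ, hmean] using h)
    (fun i => by
      rw [(hmom i 2).2]
      simp [sum_range_succ, hmean, hsecond, Nat.factorial]
      ring)
    (fun i => by
      rw [(hmom i 3).2]
      simp [sum_range_succ, hmean, hsecond, hthird])
    (fun i => by
      rw [(hmom i 4).2]
      simp [sum_range_succ, hmean, hsecond, hthird, hfourth, Nat.factorial, Nat.choose]
      ring)
    hS4int
  have hLPPxy := hLPP fun j => x j - y j
  have hest : (fun ω => ∑ i, ((∑ j, S ω i j * x j) + N ω (Sum.inl i)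
      - ((∑ j, S ω i j * y j) + N ω (Sum.inr i))) ^ 2) =
      fun ω => ∑ i, ((∑ j, S ω i j * (x j - y j)) +
        (N ω (Sum.inl i) - N ω (Sum.inr i))) ^ 2 := by
    ext ω
    refine sum_congr rfl fun i _ => ?_
    simp only [mul_sub, sum_sub_distrib]
    ring
  have hest_apply (ω : Ω) := congrFun hest ω
  simp only [hest_apply]
  rw [hLPPxy, Fintype.card_fin] at hE hVar
  constructor
  · rw [integral_sub (hL2.integrable one_le_two) (integrable_const _), hE]
    simp
    ring
  · rw [variance_sub_const hL2.aestronglyMeasurable, hVar]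
    ring
end

section
/- Let S be a random k×d real matrix satisfying the Length Preserving Property with E[‖S(x−y)‖₂⁴] finite, let x, y ∈ ℝ^d be fixed, let σ > 0, and let η, μ ∈ ℝ^k have their 2k coordinates i.i.d. distributed as N(0,σ²), independently of S. Then the estimator Ê := ‖(Sx+η) − (Sy+μ)‖₂² − 2k·σ² satisfies E[Ê] = ‖x−y‖₂² and Var[Ê] = Var[‖S(x−y)‖₂²] + 8·σ²·‖x−y‖₂² + 8·k·σ⁴. -/
open MeasureTheory ProbabilityTheory Finset
open scoped ENNReal NNReal

/-- The fourth moment of the centered Gaussian of variance `v` is `3 v²`. -/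
lemma integral_pow_four_gaussianReal (v : ℝ≥0) :
    ∫ t, t ^ 4 ∂gaussianReal 0 v = 3 * (v : ℝ) ^ 2 := by
  have h := iteratedDeriv_mgf_zero (X := id) (μ := gaussianReal 0 v)
    (by rw [integrableExpSet_id_gaussianReal]; simp) 4
  rw [mgf_id_gaussianReal] at h
  have hexp (t : ℝ) : HasDerivAt (fun t : ℝ => Real.exp (0 * t + v * t ^ 2 / 2))
      (Real.exp (0 * t + v * t ^ 2 / 2) * (v * t)) t := by
    refine HasDerivAt.exp ?_
    convert! ((hasDerivAt_id t).const_mul (0 : ℝ)).add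
      ((((hasDerivAt_id t).pow 2).const_mul (v : ℝ)).div_const 2) using 1
    simp
    ring
  have hpoly (p : Polynomial ℝ) :
      deriv (fun t : ℝ => Real.exp (0 * t + v * t ^ 2 / 2) * p.eval t) =
        fun t => Real.exp (0 * t + v * t ^ 2 / 2) *
          (Polynomial.C (v : ℝ) * Polynomial.X * p + Polynomial.derivative p).eval t := by
    funext t
    refine ((hexp t).mul (p.hasDerivAt t)).deriv.trans ?_
    simp
    ring
  have hone : (fun t : ℝ => Real.exp (0 * t + v * t ^ 2 / 2)) =
      fun t => Real.exp (0 * t + v * t ^ 2 / 2) * (1 : Polynomial ℝ).eval t := by simp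
  rw [hone] at h
  simp only [iteratedDeriv_succ, iteratedDeriv_zero, hpoly] at h
  simp at h
  rw [← h]
  ring

/-- The second moment of the centered Gaussian of variance `v` is `v`. -/
lemma integral_sq_gaussianReal (v : ℝ≥0) : ∫ t, t ^ 2 ∂gaussianReal 0 v = v := by
  rw [← variance_fun_id_gaussianReal (μ := 0) (v := v),
    variance_of_integral_eq_zero (by fun_prop) integral_id_gaussianReal]

/-- If `Z` is symmetric and independent of `A`, then functions of `(A, Z)` that are odd in `Z`
have mean zero. -/
lemma integral_eq_zero_of_odd_of_indepFun {Ω α E : Type*} [MeasurableSpace Ω] [MeasurableSpace α]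
    [MeasurableSpace E] [Neg E] [MeasurableNeg E] {P : Measure Ω} [IsFiniteMeasure P]
    {A : Ω → α} {Z : Ω → E} (hA : Measurable A) (hZ : Measurable Z) (hAZ : IndepFun A Z P)
    (hsymm : P.map (fun ω => -Z ω) = P.map Z) {F : α × E → ℝ} (hF : Measurable F)
    (hodd : ∀ a z, F (a, -z) = -F (a, z)) :
    ∫ ω, F (A ω, Z ω) ∂P = 0 := by
  have hnegZ : Measurable fun ω => -Z ω := hZ.neg
  have hAnegZ : IndepFun A (fun ω => -Z ω) P := hAZ.comp measurable_id measurable_neg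
  have hmap : P.map (fun ω => (A ω, -Z ω)) = P.map (fun ω => (A ω, Z ω)) := by
    rw [hAZ.map_prod_eq_prod_map_map hA.aemeasurable hZ.aemeasurable,
      hAnegZ.map_prod_eq_prod_map_map hA.aemeasurable hnegZ.aemeasurable, hsymm]
  have h : ∫ ω, F (A ω, -Z ω) ∂P = ∫ ω, F (A ω, Z ω) ∂P := by
    rw [← integral_map (f := F) (hA.prodMk hnegZ).aemeasurable hF.aestronglyMeasurable,
      ← integral_map (f := F) (hA.prodMk hZ).aemeasurable hF.aestronglyMeasurable, hmap]
  simp only [hodd, integral_neg] at h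
  linarith

lemma indepFun_mul_coord {Ω ι : Type*} [MeasurableSpace Ω] {P : Measure Ω}
    {A Z : Ω → ι → ℝ} (hAZ : IndepFun A Z P) (i j : ι) :
    IndepFun (fun ω => A ω i * A ω j) (fun ω => Z ω i * Z ω j) P :=
  hAZ.comp (φ := fun a : ι → ℝ => a i * a j) (ψ := fun z : ι → ℝ => z i * z j)
    (by fun_prop) (by fun_prop)

section GaussianNoise

variable {Ω ι : Type*} [MeasurableSpace Ω] [Fintype ι] {P : Measure Ω} {v : ℝ≥0}

lemma memLp_of_map_eq_gaussianReal {X : Ω → ℝ} (hX : Measurable X)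
    (hlaw : P.map X = gaussianReal 0 v) {p : ℝ≥0∞} (hp : p ≠ ∞) : MemLp X p P := by
  have h := memLp_id_gaussianReal' (μ := 0) (v := v) p hp
  rw [← hlaw] at h
  exact h.comp_of_map hX.aemeasurable

lemma integral_pow_of_map_eq_gaussianReal {X : Ω → ℝ} (hX : Measurable X)
    (hlaw : P.map X = gaussianReal 0 v) (n : ℕ) :
    ∫ ω, X ω ^ n ∂P = ∫ t, t ^ n ∂gaussianReal 0 v := by
  rw [← hlaw, integral_map hX.aemeasurable (by fun_prop)]

lemma memLp_sq_of_map_eq_gaussianReal {X : Ω → ℝ} (hX : Measurable X)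
    (hlaw : P.map X = gaussianReal 0 v) : MemLp (fun ω => X ω ^ 2) 2 P := by
  rw [memLp_two_iff_integrable_sq (by fun_prop)]
  have h := (memLp_of_map_eq_gaussianReal hX hlaw (p := (4 : ℕ)) (by simp)).integrable_norm_pow
    (by norm_num)
  refine h.congr (.of_forall fun ω => ?_)
  simp only [Real.norm_eq_abs]
  rw [← pow_mul, Even.pow_abs (by decide)]

/-- The variance of the square of a centered Gaussian of variance `v` is `2 v²`. -/
lemma variance_sq_of_map_eq_gaussianReal [IsProbabilityMeasure P] {X : Ω → ℝ} (hX : Measurable X)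
    (hlaw : P.map X = gaussianReal 0 v) : Var[fun ω => X ω ^ 2; P] = 2 * (v : ℝ) ^ 2 := by
  rw [variance_eq_sub (memLp_sq_of_map_eq_gaussianReal hX hlaw)]
  simp only [Pi.pow_apply, ← pow_mul]
  rw [integral_pow_of_map_eq_gaussianReal hX hlaw, integral_pow_of_map_eq_gaussianReal hX hlaw,
    integral_sq_gaussianReal, integral_pow_four_gaussianReal]
  ring

variable {A Z : Ω → ι → ℝ}

/-- Coordinates of a random vector whose squared norm is square-integrable are in `L²`. -/
lemma memLp_two_coord_of_memLp_sum_sq [IsFiniteMeasure P] (hA : Measurable A)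
    (hA4 : MemLp (fun ω => ∑ i, A ω i ^ 2) 2 P) (i : ι) : MemLp (fun ω => A ω i) 2 P := by
  rw [memLp_two_iff_integrable_sq (by fun_prop)]
  refine (hA4.integrable (by norm_num)).mono' (by fun_prop) (.of_forall fun ω => ?_)
  rw [Real.norm_of_nonneg (sq_nonneg _)]
  exact single_le_sum (f := fun i => A ω i ^ 2) (fun _ _ => sq_nonneg _) (mem_univ i)

lemma memLp_two_sum_mul (hA : Measurable A) (hZ : Measurable Z) (hAZ : IndepFun A Z P)
    (hA2 : ∀ i, MemLp (fun ω => A ω i) 2 P) (hZ2 : ∀ i, MemLp (fun ω => Z ω i) 2 P) :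
    MemLp (fun ω => ∑ i, A ω i * Z ω i) 2 P := by
  refine memLp_finsetSum _ fun i _ => ?_
  rw [memLp_two_iff_integrable_sq (by fun_prop)]
  refine ((indepFun_mul_coord hAZ i i).integrable_mul ((hA2 i).integrable_mul (hA2 i))
    ((hZ2 i).integrable_mul (hZ2 i))).congr (.of_forall fun ω => ?_)
  simp only [Pi.mul_apply]
  ring

/-- The second moment of `⟨A, Z⟩` is `v` times that of `A`. -/
lemma integral_sq_sum_mul (hA : Measurable A) (hZ : Measurable Z) (hAZ : IndepFun A Z P)
    (hA2 : ∀ i, MemLp (fun ω => A ω i) 2 P)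
    (hlaw : ∀ i, P.map (fun ω => Z ω i) = gaussianReal 0 v)
    (hind : Pairwise fun i j => IndepFun (fun ω => Z ω i) (fun ω => Z ω j) P) :
    ∫ ω, (∑ i, A ω i * Z ω i) ^ 2 ∂P = v * ∫ ω, ∑ i, A ω i ^ 2 ∂P := by
  classical
  have hZm (i : ι) : Measurable fun ω => Z ω i := by fun_prop
  have hZ2 (i : ι) : MemLp (fun ω => Z ω i) 2 P :=
    memLp_of_map_eq_gaussianReal (hZm i) (hlaw i) (by simp)
  have hint (i j : ι) : Integrable (fun ω => (A ω i * A ω j) * (Z ω i * Z ω j)) P :=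
    (indepFun_mul_coord hAZ i j).integrable_mul ((hA2 i).integrable_mul (hA2 j))
      ((hZ2 i).integrable_mul (hZ2 j))
  have hmean (i : ι) : ∫ ω, Z ω i ∂P = 0 := by
    have h := integral_pow_of_map_eq_gaussianReal (hZm i) (hlaw i) 1
    simpa only [pow_one, integral_id_gaussianReal] using h
  have hval (i j : ι) : ∫ ω, (A ω i * A ω j) * (Z ω i * Z ω j) ∂P =
      if i = j then v * ∫ ω, A ω i ^ 2 ∂P else 0 := by
    rw [(indepFun_mul_coord hAZ i j).integral_fun_mul_eq_mul_integral (by fun_prop) (by fun_prop)]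
    split_ifs with hij
    · subst hij
      simp only [← pow_two]
      rw [integral_pow_of_map_eq_gaussianReal (hZm i) (hlaw i), integral_sq_gaussianReal, mul_comm]
    · rw [(hind hij).integral_fun_mul_eq_mul_integral (by fun_prop) (by fun_prop), hmean i]
      simp
  have hexpand (ω : Ω) : (∑ i, A ω i * Z ω i) ^ 2 =
      ∑ i, ∑ j, (A ω i * A ω j) * (Z ω i * Z ω j) := by
    rw [pow_two, sum_mul_sum]
    exact sum_congr rfl fun i _ => sum_congr rfl fun j _ => by ring
  simp only [hexpand]
  rw [integral_finsetSum _ fun i _ => integrable_finsetSum _ fun j _ => hint i j,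
    integral_finsetSum _ fun i _ => (hA2 i).integrable_sq, mul_sum]
  refine sum_congr rfl fun i _ => ?_
  rw [integral_finsetSum _ fun j _ => hint i j]
  simp [hval]

/-- Integrability, mean and variance of `‖A + Z‖²` for Gaussian noise `Z` independent of `A`. -/
theorem integral_and_variance_sum_sq_add_gaussian [IsProbabilityMeasure P]
    (hA : Measurable A) (hZ : Measurable Z) (hAZ : IndepFun A Z P) (hA4 : MemLp (fun ω => ∑ i, A ω i ^ 2) 2 P)
    (hlaw : ∀ i, P.map (fun ω => Z ω i) = gaussianReal 0 v)
    (hind : Pairwise fun i j => IndepFun (fun ω => Z ω i) (fun ω => Z ω j) P)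
    (hsymm : P.map (fun ω => -Z ω) = P.map Z) :
    Integrable (fun ω => ∑ i, (A ω i + Z ω i) ^ 2) P ∧
    ∫ ω, ∑ i, (A ω i + Z ω i) ^ 2 ∂P = ∫ ω, ∑ i, A ω i ^ 2 ∂P + Fintype.card ι * v ∧
    Var[fun ω => ∑ i, (A ω i + Z ω i) ^ 2; P] = Var[fun ω => ∑ i, A ω i ^ 2; P]
      + 4 * v * ∫ ω, ∑ i, A ω i ^ 2 ∂P + 2 * Fintype.card ι * (v : ℝ) ^ 2 := by
  have hZm (i : ι) : Measurable fun ω => Z ω i := by fun_prop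
  have hZ4 (i : ι) : MemLp (fun ω => Z ω i ^ 2) 2 P :=
    memLp_sq_of_map_eq_gaussianReal (hZm i) (hlaw i)
  have hA2 := memLp_two_coord_of_memLp_sum_sq hA hA4
  have hZ2 (i : ι) : MemLp (fun ω => Z ω i) 2 P :=
    memLp_of_map_eq_gaussianReal (hZm i) (hlaw i) (by simp)
  have hR : MemLp (fun ω => ∑ i, Z ω i ^ 2) 2 P := memLp_finsetSum _ fun i _ => hZ4 i
  have hQ : MemLp (fun ω => 2 * ∑ i, A ω i * Z ω i) 2 P :=
    (memLp_two_sum_mul hA hZ hAZ hA2 hZ2).const_mul 2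
  have hPR : MemLp (fun ω => ∑ i, A ω i ^ 2 + ∑ i, Z ω i ^ 2) 2 P := hA4.add hR
  have hexpand (ω : Ω) : ∑ i, (A ω i + Z ω i) ^ 2 =
      (∑ i, A ω i ^ 2 + ∑ i, Z ω i ^ 2) + 2 * ∑ i, A ω i * Z ω i := by
    rw [mul_sum, ← sum_add_distrib, ← sum_add_distrib]
    exact sum_congr rfl fun i _ => by ring
  have hQ0 : ∫ ω, 2 * ∑ i, A ω i * Z ω i ∂P = 0 :=
    integral_eq_zero_of_odd_of_indepFun hA hZ hAZ hsymm
      (F := fun p => 2 * ∑ i, p.1 i * p.2 i) (by fun_prop) (by simp)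
  have hcov : cov[fun ω => ∑ i, A ω i ^ 2 + ∑ i, Z ω i ^ 2,
      fun ω => 2 * ∑ i, A ω i * Z ω i; P] = 0 := by
    rw [covariance_eq_sub hPR hQ, hQ0, mul_zero, sub_zero]
    exact integral_eq_zero_of_odd_of_indepFun hA hZ hAZ hsymm
      (F := fun p => (∑ i, p.1 i ^ 2 + ∑ i, p.2 i ^ 2) * (2 * ∑ i, p.1 i * p.2 i))
      (by fun_prop) (by simp)
  have hindPR : IndepFun (fun ω => ∑ i, A ω i ^ 2) (fun ω => ∑ i, Z ω i ^ 2) P :=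
    hAZ.comp (φ := fun a : ι → ℝ => ∑ i, a i ^ 2) (ψ := fun z : ι → ℝ => ∑ i, z i ^ 2)
      (by fun_prop) (by fun_prop)
  have hvarR : Var[fun ω => ∑ i, Z ω i ^ 2; P] = 2 * Fintype.card ι * (v : ℝ) ^ 2 := by
    have h := IndepFun.variance_sum (s := univ) (fun i _ => hZ4 i) fun i _ j _ hij =>
      (hind hij).comp (φ := fun t : ℝ => t ^ 2) (ψ := fun t : ℝ => t ^ 2)
        (by fun_prop) (by fun_prop)
    rw [sum_fn] at h
    rw [h, sum_congr rfl fun i _ => variance_sq_of_map_eq_gaussianReal (hZm i) (hlaw i)]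
    simp
    ring
  have hvarQ : Var[fun ω => 2 * ∑ i, A ω i * Z ω i; P] = 4 * v * ∫ ω, ∑ i, A ω i ^ 2 ∂P := by
    rw [variance_of_integral_eq_zero (by fun_prop) hQ0]
    simp only [mul_pow]
    rw [integral_const_mul, integral_sq_sum_mul hA hZ hAZ hA2 hlaw hind]
    ring
  simp only [hexpand]
  refine ⟨(hPR.add hQ).integrable (by norm_num), ?_, ?_⟩
  · rw [integral_add (hPR.integrable (by norm_num)) (hQ.integrable (by norm_num)), hQ0,
      integral_add (hA4.integrable (by norm_num)) (hR.integrable (by norm_num)),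
      integral_finsetSum _ fun i _ => (hZ2 i).integrable_sq,
      sum_congr rfl fun i _ => integral_pow_of_map_eq_gaussianReal (hZm i) (hlaw i) 2]
    simp [integral_sq_gaussianReal]
  · rw [variance_fun_add hPR hQ, hcov, hindPR.variance_fun_add hA4 hR, hvarR, hvarQ]
    ring

end GaussianNoise

/-- Let `S` be a random `k × d` matrix satisfying the Length Preserving
Property with `E[‖S(x-y)‖₂⁴]` finite, let `x, y ∈ ℝ^d` be fixed, let `σ > 0`, and let
`η = N ∘ Sum.inl`, `μ = N ∘ Sum.inr` have their `2k` coordinates i.i.d. `N(0, σ²)`,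
independently of `S`.  Then `Ê = ‖(Sx+η) - (Sy+μ)‖₂² - 2 k σ²` satisfies
`E[Ê] = ‖x-y‖₂²` and `Var[Ê] = Var[‖S(x-y)‖₂²] + 8 σ² ‖x-y‖₂² + 8 k σ⁴`. -/
theorem gaussian_noise_estimator
    {Ω : Type*} [MeasurableSpace Ω] (Pr : Measure Ω) [IsProbabilityMeasure Pr]
    (k d : ℕ)
    (S : Ω → Fin k → Fin d → ℝ) (hSmeas : Measurable S)
    (hLPP : ∀ z : Fin d → ℝ,
      (∫ ω, ∑ i, (∑ j, S ω i j * z j) ^ 2 ∂Pr) = ∑ j, (z j) ^ 2)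
    (σ : ℝ) (hσ : 0 < σ)
    (N : Ω → (Fin k ⊕ Fin k) → ℝ) (hNmeas : Measurable N)
    (hNlaw : Measure.map N Pr = Measure.pi (fun _ => gaussianReal 0 (σ ^ 2).toNNReal))
    (hindep : IndepFun S N Pr)
    (x y : Fin d → ℝ)
    (hS4int : Integrable
      (fun ω => (∑ i, (∑ j, S ω i j * (x j - y j)) ^ 2) ^ 2) Pr) :
    (∫ ω, (∑ i, ((∑ j, S ω i j * x j) + N ω (Sum.inl i)
          - ((∑ j, S ω i j * y j) + N ω (Sum.inr i))) ^ 2)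
        - 2 * (k : ℝ) * σ ^ 2 ∂Pr) = ∑ j, (x j - y j) ^ 2
    ∧ variance (fun ω =>
        (∑ i, ((∑ j, S ω i j * x j) + N ω (Sum.inl i)
          - ((∑ j, S ω i j * y j) + N ω (Sum.inr i))) ^ 2)
        - 2 * (k : ℝ) * σ ^ 2) Pr
      = variance (fun ω => ∑ i, (∑ j, S ω i j * (x j - y j)) ^ 2) Pr
        + 8 * σ ^ 2 * (∑ j, (x j - y j) ^ 2)
        + 8 * (k : ℝ) * σ ^ 4 := by
  set v : ℝ≥0 := (σ ^ 2).toNNReal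
  have hvσ : (v : ℝ) = σ ^ 2 := Real.coe_toNNReal _ (sq_nonneg σ)
  have hNcoord (s : Fin k ⊕ Fin k) : Pr.map (fun ω => N ω s) = gaussianReal 0 v := by
    have h : (Pr.map N).map (Function.eval s) = gaussianReal 0 v := by
      rw [hNlaw, (measurePreserving_eval _ s).map_eq]
    rwa [Measure.map_map (measurable_pi_apply s) hNmeas] at h
  have hNindep : iIndepFun (fun s ω => N ω s) Pr := by
    rw [iIndepFun_iff_map_fun_eq_pi_map fun s => by fun_prop]
    simp only [hNcoord]
    exact hNlaw
  have hNsymm : Pr.map (fun ω => -N ω) = Pr.map N := by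
    have h : (Pr.map N).map (fun n s => -n s) = Pr.map N := by
      rw [hNlaw, Measure.pi_map_pi (f := fun _ t => -t) fun _ => by fun_prop]
      simp [gaussianReal_map_neg]
    rwa [Measure.map_map (by fun_prop) hNmeas] at h
  let D : (Fin k ⊕ Fin k → ℝ) → Fin k → ℝ := fun n i => n (.inl i) - n (.inr i)
  let B : (Fin k → Fin d → ℝ) → Fin k → ℝ := fun M i => ∑ j, M i j * (x j - y j)
  have hD : Measurable D := by fun_prop
  have hB : Measurable B := by fun_prop
  have hlaw (i : Fin k) : Pr.map (fun ω => D (N ω) i) = gaussianReal 0 (v + v) := by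
    have hneg : Pr.map (fun ω => -N ω (.inr i)) = gaussianReal 0 v := by
      have h := gaussianReal_map_neg (μ := 0) (v := v)
      rw [← hNcoord (.inr i), Measure.map_map measurable_neg (by fun_prop)] at h
      rwa [neg_zero] at h
    have hind : IndepFun (fun ω => N ω (.inl i)) (fun ω => -N ω (.inr i)) Pr :=
      (hNindep.indepFun (i := .inl i) (j := .inr i) (by simp)).comp measurable_id measurable_neg
    have h := gaussianReal_add_gaussianReal_of_indepFun hind (hNcoord (.inl i)) hneg
    rw [zero_add] at h
    rw [← h]
    congr 1
  have hind : Pairwise fun i j => IndepFun (fun ω => D (N ω) i) (fun ω => D (N ω) j) Pr := by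
    intro i j hij
    exact (hNindep.indepFun_prodMk_prodMk (fun s => by fun_prop) (.inl i) (.inr i) (.inl j) (.inr j)
      (by simpa) (by simp) (by simp) (by simpa)).comp
        (φ := fun p : ℝ × ℝ => p.1 - p.2) (ψ := fun p : ℝ × ℝ => p.1 - p.2)
        (by fun_prop) (by fun_prop)
  have hsymm : Pr.map (fun ω => -D (N ω)) = Pr.map (fun ω => D (N ω)) := by
    have h : (Pr.map (fun ω => -N ω)).map D = (Pr.map N).map D := by rw [hNsymm]
    rw [Measure.map_map hD (by fun_prop), Measure.map_map hD hNmeas] at h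
    rw [show (fun ω => -D (N ω)) = D ∘ fun ω => -N ω by
      funext ω i
      simp only [D, Function.comp_apply, Pi.neg_apply]
      ring]
    exact h
  have hA4 : MemLp (fun ω => ∑ i, B (S ω) i ^ 2) 2 Pr := by
    rw [memLp_two_iff_integrable_sq (by fun_prop)]
    exact hS4int
  have hexpand (ω : Ω) : ∑ i, ((∑ j, S ω i j * x j) + N ω (Sum.inl i)
      - ((∑ j, S ω i j * y j) + N ω (Sum.inr i))) ^ 2 = ∑ i, (B (S ω) i + D (N ω) i) ^ 2 := by
    refine sum_congr rfl fun i _ => ?_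
    simp only [B, D, mul_sub, sum_sub_distrib]
    ring
  obtain ⟨hint, hmean, hvar⟩ := integral_and_variance_sum_sq_add_gaussian (hB.comp hSmeas)
    (hD.comp hNmeas) (hindep.comp hB hD) hA4 hlaw hind hsymm
  have hLPPxy : ∫ ω, ∑ i, B (S ω) i ^ 2 ∂Pr = ∑ j, (x j - y j) ^ 2 := hLPP fun j => x j - y j
  simp only [Function.comp_apply, hLPPxy, Fintype.card_fin, NNReal.coe_add, hvσ] at hint hmean hvar
  simp only [hexpand]
  constructor
  · rw [integral_sub hint (integrable_const _), hmean]
    simp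
    ring
  · rw [variance_sub_const (by fun_prop), hvar]
    simp only [B]
    ring
end

section
/- The normalized FJLT preserves squared Euclidean norm in expectation: with Φ the FJLT as in the context, for every x ∈ ℝ^d one has E[‖Φx‖₂²] = k·‖x‖₂², i.e. E[(1/k)·‖Φx‖₂²] = ‖x‖₂². -/
open MeasureTheory ProbabilityTheory Finset
open scoped ENNReal NNReal

/-- Uniform distribution on `{-1, +1} ⊆ ℝ` (law of a Rademacher sign). -/
noncomputable def signMeasure : Measure ℝ :=
  ((2 : ℝ≥0)⁻¹) • Measure.dirac (-1) + ((2 : ℝ≥0)⁻¹) • Measure.dirac 1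

instance : IsFiniteMeasure signMeasure := by unfold signMeasure; infer_instance

/-- Distribution of an entry of the FJLT matrix `P`: a sample of `N(0, 1/q)` with
probability `q` and `0` with probability `1 - q`. -/
noncomputable def fjltEntryMeasure (q : ℝ) : Measure ℝ :=
  q.toNNReal • gaussianReal 0 q.toNNReal⁻¹ + (1 - q).toNNReal • Measure.dirac 0

instance (q : ℝ) : IsFiniteMeasure (fjltEntryMeasure q) := by
  unfold fjltEntryMeasure; infer_instance

/-- The normalized `2^m × 2^m` Hadamard matrix: `H f j = d^{-1/2} * (-1)^{⟨f, j⟩}`,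
where `⟨f, j⟩` is the inner product of the binary expansions of `f` and `j`. -/
noncomputable def hadamardMat (m : ℕ) (f j : Fin (2 ^ m)) : ℝ :=
  (-1 : ℝ) ^ (∑ b ∈ Finset.range m, if f.val.testBit b && j.val.testBit b then 1 else 0) /
    Real.sqrt (2 ^ m)

/-- The `(i, j)` entry of the FJLT matrix `Φ = P·H·D`, given the realizations of the
sparse Gaussian matrix `P` and the diagonal sign vector `D`. -/
noncomputable def fjltEntry {m k : ℕ} (P : (Fin k × Fin (2 ^ m)) → ℝ)
    (D : Fin (2 ^ m) → ℝ) (i : Fin k) (j : Fin (2 ^ m)) : ℝ :=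
  ∑ f, P (i, f) * hadamardMat m f j * D j

theorem hadamardMat_mul_self (m : ℕ) (f j : Fin (2 ^ m)) :
    hadamardMat m f j * hadamardMat m f j = 1 / 2 ^ m := by
  have h : √((2 : ℝ) ^ m) * √(2 ^ m) = 2 ^ m := Real.mul_self_sqrt (by positivity)
  rw [hadamardMat, div_mul_div_comm, h, ← mul_pow]
  norm_num

theorem sum_hadamardMat_mul_self (m : ℕ) (j : Fin (2 ^ m)) :
    ∑ f, hadamardMat m f j * hadamardMat m f j = 1 := by
  simp [hadamardMat_mul_self]

/-- A law on `ℝ` that is centered with unit second moment. -/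
structure IsStandardized (μ : Measure ℝ) : Prop where
  isProbabilityMeasure : IsProbabilityMeasure μ
  memLp_two : MemLp id 2 μ
  integral_id : ∫ t, t ∂μ = 0
  integral_mul_self : ∫ t, t * t ∂μ = 1

theorem isStandardized_signMeasure : IsStandardized signMeasure where
  isProbabilityMeasure := by
    constructor
    simp only [signMeasure, Measure.add_apply, Measure.smul_apply, measure_univ]
    rw [ENNReal.smul_def, smul_eq_mul, mul_one, ← ENNReal.coe_add]
    norm_num [← two_mul]
  memLp_two := by
    rw [memLp_two_iff_integrable_sq aestronglyMeasurable_id, signMeasure]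
    exact (integrable_dirac (by simp)).smul_measure_nnreal.add_measure
      (integrable_dirac (by simp)).smul_measure_nnreal
  integral_id := by
    rw [signMeasure, integral_add_measure
      (integrable_dirac (by simp)).smul_measure_nnreal
      (integrable_dirac (by simp)).smul_measure_nnreal,
      integral_smul_nnreal_measure, integral_smul_nnreal_measure, integral_dirac, integral_dirac,
      NNReal.smul_def, NNReal.smul_def]
    norm_num
  integral_mul_self := by
    rw [signMeasure, integral_add_measure
      (integrable_dirac (by simp)).smul_measure_nnreal
      (integrable_dirac (by simp)).smul_measure_nnreal,
      integral_smul_nnreal_measure, integral_smul_nnreal_measure, integral_dirac, integral_dirac,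
      NNReal.smul_def, NNReal.smul_def]
    norm_num

theorem integral_mul_self_gaussianReal_zero (v : ℝ≥0) :
    ∫ t, t * t ∂(gaussianReal 0 v) = v := by
  have h := variance_fun_id_gaussianReal (μ := 0) (v := v)
  rw [variance_of_integral_eq_zero (by fun_prop) (by simp [integral_id_gaussianReal])] at h
  simpa only [pow_two] using h

theorem isStandardized_fjltEntryMeasure {q : ℝ} (hq0 : 0 < q) (hq1 : q ≤ 1) :
    IsStandardized (fjltEntryMeasure q) := by
  have hid : MemLp id 2 (gaussianReal 0 q.toNNReal⁻¹) := memLp_id_gaussianReal 2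
  have hint : Integrable (fun t : ℝ => t) (gaussianReal 0 q.toNNReal⁻¹) :=
    hid.integrable (by norm_num)
  have hsq : Integrable (fun t : ℝ => t * t) (gaussianReal 0 q.toNNReal⁻¹) :=
    hid.integrable_mul hid
  refine ⟨⟨?_⟩, ?_, ?_, ?_⟩
  · simp only [fjltEntryMeasure, Measure.add_apply, Measure.smul_apply, measure_univ]
    rw [ENNReal.smul_def, ENNReal.smul_def, smul_eq_mul, smul_eq_mul, mul_one, mul_one,
      ← ENNReal.coe_add, ← Real.toNNReal_add hq0.le (sub_nonneg.mpr hq1)]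
    simp
  · rw [memLp_two_iff_integrable_sq aestronglyMeasurable_id, fjltEntryMeasure]
    exact hid.integrable_sq.smul_measure_nnreal.add_measure
      (integrable_dirac (by simp)).smul_measure_nnreal
  · rw [fjltEntryMeasure, integral_add_measure hint.smul_measure_nnreal
      (integrable_dirac (by simp)).smul_measure_nnreal,
      integral_smul_nnreal_measure, integral_smul_nnreal_measure, integral_dirac,
      integral_id_gaussianReal]
    simp
  · rw [fjltEntryMeasure, integral_add_measure hsq.smul_measure_nnreal
      (integrable_dirac (by simp)).smul_measure_nnreal,
      integral_smul_nnreal_measure, integral_smul_nnreal_measure, integral_dirac,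
      integral_mul_self_gaussianReal_zero, NNReal.smul_def]
    simp [hq0.le, hq0.ne']

section Coordinates

variable {Ω ι : Type*} [MeasurableSpace Ω] [Fintype ι] {Pr : Measure Ω} {μ : Measure ℝ}
  {X : Ω → ι → ℝ}

theorem IsStandardized.memLp_coord (hμ : IsStandardized μ) (hX : Measurable X)
    (hlaw : Measure.map X Pr = Measure.pi fun _ => μ) (a : ι) :
    MemLp (fun ω => X ω a) 2 Pr := by
  have := hμ.isProbabilityMeasure
  have h : MemLp (fun p : ι → ℝ => p a) 2 (Measure.pi fun _ : ι => μ) :=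
    hμ.memLp_two.comp_measurePreserving (measurePreserving_eval (fun _ : ι => μ) a)
  exact h.comp_measurePreserving ⟨hX, hlaw⟩

theorem IsStandardized.integrable_coord_mul (hμ : IsStandardized μ) (hX : Measurable X)
    (hlaw : Measure.map X Pr = Measure.pi fun _ => μ) (a b : ι) :
    Integrable (fun ω => X ω a * X ω b) Pr :=
  (hμ.memLp_coord hX hlaw a).integrable_mul (hμ.memLp_coord hX hlaw b)

theorem IsStandardized.integral_coord_mul [DecidableEq ι] (hμ : IsStandardized μ)
    (hX : Measurable X) (hlaw : Measure.map X Pr = Measure.pi fun _ => μ) (a b : ι) :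
    ∫ ω, X ω a * X ω b ∂Pr = if a = b then 1 else 0 := by
  have := hμ.isProbabilityMeasure
  have hmap : ∫ ω, X ω a * X ω b ∂Pr = ∫ p : ι → ℝ, p a * p b ∂(Measure.pi fun _ => μ) := by
    rw [← hlaw, integral_map hX.aemeasurable (by fun_prop)]
  rw [hmap]
  split_ifs with hab
  · subst hab
    rw [integral_comp_eval (μ := fun _ : ι => μ) (i := a) (f := fun t : ℝ => t * t)
      (by fun_prop), hμ.integral_mul_self]
  · have hind : iIndepFun (fun (i : ι) (p : ι → ℝ) => p i) (Measure.pi fun _ => μ) :=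
      iIndepFun_pi (X := fun _ t => t) fun _ => aemeasurable_id
    rw [(hind.indepFun hab).integral_fun_mul_eq_mul_integral
      (measurable_pi_apply a).aestronglyMeasurable (measurable_pi_apply b).aestronglyMeasurable,
      integral_comp_eval (μ := fun _ : ι => μ) (i := a) (f := fun t : ℝ => t) (by fun_prop),
      hμ.integral_id, zero_mul]

end Coordinates

theorem sq_sum_fjltEntry_mul {m k : ℕ} (P : (Fin k × Fin (2 ^ m)) → ℝ) (D x : Fin (2 ^ m) → ℝ)
    (i : Fin k) :
    (∑ j, fjltEntry P D i j * x j) ^ 2 = ∑ j, ∑ l, ∑ f, ∑ g,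
      (P (i, f) * P (i, g)) * (D j * D l) *
        (hadamardMat m f j * hadamardMat m g l * (x j * x l)) := by
  rw [pow_two, Finset.sum_mul_sum]
  refine sum_congr rfl fun j _ => sum_congr rfl fun l _ => ?_
  rw [fjltEntry, fjltEntry, mul_mul_mul_comm, Finset.sum_mul_sum]
  simp only [Finset.sum_mul]
  exact sum_congr rfl fun f _ => sum_congr rfl fun g _ => by ring

theorem integral_sum_sq_fjlt
    {Ω : Type*} [MeasurableSpace Ω] {Pr : Measure Ω}
    {m k : ℕ} {q : ℝ} (hq0 : 0 < q) (hq1 : q ≤ 1)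
    {P : Ω → (Fin k × Fin (2 ^ m)) → ℝ} (hPmeas : Measurable P)
    (hPlaw : Measure.map P Pr = Measure.pi (fun _ => fjltEntryMeasure q))
    {D : Ω → Fin (2 ^ m) → ℝ} (hDmeas : Measurable D)
    (hDlaw : Measure.map D Pr = Measure.pi (fun _ => signMeasure))
    (hindep : IndepFun P D Pr) (x : Fin (2 ^ m) → ℝ) :
    ∫ ω, ∑ i : Fin k, (∑ j, fjltEntry (P ω) (D ω) i j * x j) ^ 2 ∂Pr
      = (k : ℝ) * ∑ j, (x j) ^ 2 := by
  have hP := isStandardized_fjltEntryMeasure hq0 hq1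
  have hD := isStandardized_signMeasure
  have hind (a b : Fin k × Fin (2 ^ m)) (j l : Fin (2 ^ m)) :
      IndepFun (fun ω => P ω a * P ω b) (fun ω => D ω j * D ω l) Pr :=
    hindep.comp (φ := fun p : Fin k × Fin (2 ^ m) → ℝ => p a * p b)
      (ψ := fun e : Fin (2 ^ m) → ℝ => e j * e l) (by fun_prop) (by fun_prop)
  have hint (a b : Fin k × Fin (2 ^ m)) (j l : Fin (2 ^ m)) (c : ℝ) :
      Integrable (fun ω => (P ω a * P ω b) * (D ω j * D ω l) * c) Pr :=
    ((hind a b j l).integrable_mul (hP.integrable_coord_mul hPmeas hPlaw a b)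
      (hD.integrable_coord_mul hDmeas hDlaw j l)).mul_const c
  have hval (a b : Fin k × Fin (2 ^ m)) (j l : Fin (2 ^ m)) (c : ℝ) :
      ∫ ω, (P ω a * P ω b) * (D ω j * D ω l) * c ∂Pr =
        (if a = b then 1 else 0) * (if j = l then 1 else 0) * c := by
    rw [integral_mul_const, (hind a b j l).integral_fun_mul_eq_mul_integral (by fun_prop)
      (by fun_prop), hP.integral_coord_mul hPmeas hPlaw, hD.integral_coord_mul hDmeas hDlaw]
  simp only [sq_sum_fjltEntry_mul]
  have hrow (i : Fin k) : ∫ ω, ∑ j, ∑ l, ∑ f, ∑ g, (P ω (i, f) * P ω (i, g)) * (D ω j * D ω l) *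
      (hadamardMat m f j * hadamardMat m g l * (x j * x l)) ∂Pr = ∑ j, x j ^ 2 := by
    rw [integral_finsetSum _ fun j _ => integrable_finsetSum _ fun l _ =>
      integrable_finsetSum _ fun f _ => integrable_finsetSum _ fun g _ => hint _ _ _ _ _]
    refine sum_congr rfl fun j _ => ?_
    rw [integral_finsetSum _ fun l _ =>
      integrable_finsetSum _ fun f _ => integrable_finsetSum _ fun g _ => hint _ _ _ _ _]
    have hcol (l : Fin (2 ^ m)) : ∫ ω, ∑ f, ∑ g, (P ω (i, f) * P ω (i, g)) * (D ω j * D ω l) *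
        (hadamardMat m f j * hadamardMat m g l * (x j * x l)) ∂Pr =
        if j = l then x j ^ 2 else 0 := by
      rw [integral_finsetSum _ fun f _ => integrable_finsetSum _ fun g _ => hint _ _ _ _ _]
      simp only [integral_finsetSum _ fun g _ => hint _ (_, g) _ _ _, hval]
      split_ifs with hjl
      · subst hjl
        simp [← Finset.sum_mul, sum_hadamardMat_mul_self, pow_two]
      · simp
    simp [hcol]
  rw [integral_finsetSum _ fun i _ => integrable_finsetSum _ fun j _ =>
    integrable_finsetSum _ fun l _ => integrable_finsetSum _ fun f _ =>
    integrable_finsetSum _ fun g _ => hint _ _ _ _ _]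
  simp [hrow]

theorem fjlt_lpp
    {Ω : Type*} [MeasurableSpace Ω] (Pr : Measure Ω) [IsProbabilityMeasure Pr]
    (m k : ℕ) (hk : 0 < k) (q : ℝ) (hq0 : 0 < q) (hq1 : q ≤ 1)
    (P : Ω → (Fin k × Fin (2 ^ m)) → ℝ) (hPmeas : Measurable P)
    (hPlaw : Measure.map P Pr = Measure.pi (fun _ => fjltEntryMeasure q))
    (D : Ω → Fin (2 ^ m) → ℝ) (hDmeas : Measurable D)
    (hDlaw : Measure.map D Pr = Measure.pi (fun _ => signMeasure))
    (hindep : IndepFun P D Pr)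
    (x : Fin (2 ^ m) → ℝ) :
    (∫ ω, ∑ i : Fin k, (∑ j, fjltEntry (P ω) (D ω) i j * x j) ^ 2 ∂Pr)
      = (k : ℝ) * ∑ j, (x j) ^ 2
    ∧ (∫ ω, (1 / (k : ℝ)) * ∑ i : Fin k, (∑ j, fjltEntry (P ω) (D ω) i j * x j) ^ 2 ∂Pr)
      = ∑ j, (x j) ^ 2 := by
  have h := integral_sum_sq_fjlt hq0 hq1 hPmeas hPlaw hDmeas hDlaw hindep x
  refine ⟨h, ?_⟩
  rw [integral_const_mul, h]
  field_simp
end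

section
/- Let Φ be the FJLT as in the context with sparsity parameter q satisfying q ≥ 9/(d+9). Then for all x, y ∈ ℝ^d, Var[(1/k)·‖Φx − Φy‖₂²] ≤ (3/k)·‖x−y‖₂⁴. -/
open MeasureTheory ProbabilityTheory Finset
open scoped ENNReal NNReal

section FourthMoment

variable {Ω ι : Type*} [MeasurableSpace Ω] {μ : Measure Ω}

lemma MeasureTheory.MemLp.integrable_pow_of_le [IsFiniteMeasure μ] {f : Ω → ℝ} {N n : ℕ}
    (hf : MemLp f N μ) (hn : n ≤ N) : Integrable (fun ω => f ω ^ n) μ := by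
  have h : MemLp f n μ := hf.mono_exponent (by exact_mod_cast hn)
  refine (h.integrable_norm_pow').mono (h.aestronglyMeasurable.pow n) (ae_of_all _ fun ω => ?_)
  simp

/-- Second and fourth moments of the sum of two independent centered variables. -/
lemma ProbabilityTheory.IndepFun.integral_add_pow_four [IsProbabilityMeasure μ] {A B : Ω → ℝ}
    (hAB : IndepFun A B μ) (hA : MemLp A 4 μ) (hB : MemLp B 4 μ)
    (hA1 : ∫ ω, A ω ∂μ = 0) (hB1 : ∫ ω, B ω ∂μ = 0) :
    ∫ ω, (A ω + B ω) ^ 2 ∂μ = (∫ ω, A ω ^ 2 ∂μ) + ∫ ω, B ω ^ 2 ∂μ ∧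
    ∫ ω, (A ω + B ω) ^ 4 ∂μ = (∫ ω, A ω ^ 4 ∂μ)
      + 6 * ((∫ ω, A ω ^ 2 ∂μ) * ∫ ω, B ω ^ 2 ∂μ) + ∫ ω, B ω ^ 4 ∂μ := by
  have iA (n : ℕ) (hn : n ≤ 4) : Integrable (fun ω => A ω ^ n) μ :=
    MemLp.integrable_pow_of_le (N := 4) (by exact_mod_cast hA) hn
  have iB (n : ℕ) (hn : n ≤ 4) : Integrable (fun ω => B ω ^ n) μ :=
    MemLp.integrable_pow_of_le (N := 4) (by exact_mod_cast hB) hn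
  have hind (a b : ℕ) : IndepFun (fun ω => A ω ^ a) (fun ω => B ω ^ b) μ :=
    hAB.comp (φ := fun x => x ^ a) (ψ := fun x => x ^ b) (by fun_prop) (by fun_prop)
  have iAB (a b : ℕ) (ha : a ≤ 4) (hb : b ≤ 4) : Integrable (fun ω => A ω ^ a * B ω ^ b) μ :=
    (hind a b).integrable_mul (iA a ha) (iB b hb)
  have eAB (a b : ℕ) (ha : a ≤ 4) (hb : b ≤ 4) :
      ∫ ω, A ω ^ a * B ω ^ b ∂μ = (∫ ω, A ω ^ a ∂μ) * ∫ ω, B ω ^ b ∂μ :=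
    (hind a b).integral_fun_mul_eq_mul_integral (iA a ha).1 (iB b hb).1
  constructor
  · have h (ω : Ω) : (A ω + B ω) ^ 2 = A ω ^ 2 + 2 * (A ω ^ 1 * B ω ^ 1) + B ω ^ 2 := by ring
    have i2 := (iAB 1 1 (by lia) (by lia)).const_mul 2
    simp_rw [h]
    rw [integral_add ((iA 2 (by lia)).fun_add i2) (iB 2 (by lia)), integral_add (iA 2 (by lia)) i2,
      integral_const_mul, eAB 1 1 (by lia) (by lia)]
    simp [hA1]
  · have h (ω : Ω) : (A ω + B ω) ^ 4 = A ω ^ 4 + 4 * (A ω ^ 3 * B ω ^ 1)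
        + 6 * (A ω ^ 2 * B ω ^ 2) + 4 * (A ω ^ 1 * B ω ^ 3) + B ω ^ 4 := by ring
    have i1 := (iAB 3 1 (by lia) (by lia)).const_mul 4
    have i2 := (iAB 2 2 (by lia) (by lia)).const_mul 6
    have i3 := (iAB 1 3 (by lia) (by lia)).const_mul 4
    have i0 := iA 4 le_rfl
    simp_rw [h]
    rw [integral_add (((i0.fun_add i1).fun_add i2).fun_add i3) (iB 4 le_rfl),
      integral_add ((i0.fun_add i1).fun_add i2) i3, integral_add (i0.fun_add i1) i2, integral_add i0 i1,
      integral_const_mul, integral_const_mul, integral_const_mul, eAB 3 1 (by lia) (by lia),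
      eAB 2 2 (by lia) (by lia), eAB 1 3 (by lia) (by lia)]
    simp [hA1, hB1]

/-- First, second and fourth moments of a linear combination of independent standardized
variables with common fourth moment `κ`. -/
lemma integral_sum_mul_pow_of_iIndepFun [IsProbabilityMeasure μ] {ξ : ι → Ω → ℝ}
    (hξ : iIndepFun ξ μ) (hm : ∀ i, Measurable (ξ i)) (hL : ∀ i, MemLp (ξ i) 4 μ) {κ : ℝ}
    (h1 : ∀ i, ∫ ω, ξ i ω ∂μ = 0) (h2 : ∀ i, ∫ ω, ξ i ω ^ 2 ∂μ = 1)
    (h4 : ∀ i, ∫ ω, ξ i ω ^ 4 ∂μ = κ) (u : ι → ℝ) (s : Finset ι) :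
    ∫ ω, ∑ i ∈ s, u i * ξ i ω ∂μ = 0 ∧
    ∫ ω, (∑ i ∈ s, u i * ξ i ω) ^ 2 ∂μ = ∑ i ∈ s, u i ^ 2 ∧
    ∫ ω, (∑ i ∈ s, u i * ξ i ω) ^ 4 ∂μ
      = 3 * (∑ i ∈ s, u i ^ 2) ^ 2 + (κ - 3) * ∑ i ∈ s, u i ^ 4 := by
  classical
  have hLu (i : ι) : MemLp (fun ω => u i * ξ i ω) 4 μ := (hL i).const_mul _
  have hsum (s : Finset ι) : ∫ ω, ∑ i ∈ s, u i * ξ i ω ∂μ = 0 := by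
    rw [integral_finsetSum _ fun i _ => (hLu i).integrable (by norm_num)]
    simp [integral_const_mul, h1]
  refine ⟨hsum s, ?_⟩
  induction s using Finset.induction_on with
  | empty => simp
  | insert a s ha ih =>
    have hind : IndepFun (fun ω => u a * ξ a ω) (fun ω => ∑ i ∈ s, u i * ξ i ω) μ := by
      have h := (hξ.comp (fun i x => u i * x) fun i => by fun_prop).indepFun_finsetSum_of_notMem
        (fun i => by have := hm i; fun_prop) ha
      convert! h.symm using 1
      ext ω
      simp
    obtain ⟨e2, e4⟩ := hind.integral_add_pow_four (hLu a)
      (memLp_finsetSum _ fun i _ => hLu i) (by simp [integral_const_mul, h1]) (hsum s)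
    simp_rw [Finset.sum_insert ha, e2, e4, ih.1, ih.2, mul_pow, integral_const_mul, h2, h4]
    constructor <;> ring

end FourthMoment

lemma integral_pow_four_gaussianReal_zero (v : ℝ≥0) :
    ∫ x, x ^ 4 ∂(gaussianReal 0 v) = 3 * (v : ℝ) ^ 2 := by
  have h := iteratedDeriv_mgf_zero (X := id) (μ := gaussianReal 0 v)
    (by simp [integrableExpSet_id_gaussianReal]) 4
  simp only [Pi.pow_apply, id] at h
  rw [← h, mgf_id_gaussianReal]
  have hd (p dp : ℝ → ℝ) (hp : ∀ t, HasDerivAt p (dp t) t) :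
      deriv (fun t => p t * Real.exp (v * t ^ 2 / 2))
        = fun t => (dp t + p t * (v * t)) * Real.exp (v * t ^ 2 / 2) := by
    ext t
    have h1 : HasDerivAt (fun t : ℝ => (v : ℝ) * t ^ 2 / 2) (v * t) t := by
      convert! (((hasDerivAt_id t).pow 2).const_mul (v : ℝ)).div_const 2 using 1
      simp; ring
    rw [((hp t).fun_mul h1.exp).deriv]
    ring
  have e0 : (fun t : ℝ => Real.exp (0 * t + v * t ^ 2 / 2))
      = fun t => 1 * Real.exp (v * t ^ 2 / 2) := by simp
  simp only [iteratedDeriv_succ', iteratedDeriv_zero]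
  rw [e0, hd (fun _ => 1) (fun _ => 0) fun t => hasDerivAt_const t 1,
    hd _ (fun _ => v) fun t => by simpa using (hasDerivAt_id t).const_mul (v : ℝ),
    hd _ (fun t => 2 * (v : ℝ) ^ 2 * t) fun t => by
      convert! (((hasDerivAt_id t).const_mul (v : ℝ)).pow 2).const_add (v : ℝ) using 1
      · ext t; simp; ring
      · simp; ring,
    hd _ (fun t => 3 * (v : ℝ) ^ 2 + 3 * (v : ℝ) ^ 3 * t ^ 2) fun t => by
      convert! ((hasDerivAt_id t).const_mul (3 * (v : ℝ) ^ 2)).add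
        (((hasDerivAt_id t).pow 3).const_mul ((v : ℝ) ^ 3)) using 1
      · ext t; simp; ring
      · simp; ring]
  simp

instance : IsProbabilityMeasure signMeasure := by
  refine ⟨?_⟩
  simp [signMeasure, ENNReal.inv_two_add_inv_two, ENNReal.smul_def]

lemma ae_sq_eq_one_signMeasure : ∀ᵐ x ∂signMeasure, x ^ 2 = 1 := by
  rw [signMeasure, ae_add_measure_iff]
  constructor <;> exact Measure.ae_smul_measure (by simp [ae_dirac_eq]) _

lemma integral_signMeasure (f : ℝ → ℝ) : ∫ x, f x ∂signMeasure = (f (-1) + f 1) / 2 := by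
  rw [signMeasure, integral_add_measure, integral_smul_nnreal_measure,
    integral_smul_nnreal_measure, integral_dirac, integral_dirac]
  · simp [NNReal.smul_def]; ring
  · exact (integrable_dirac (by simp)).smul_measure_nnreal
  · exact (integrable_dirac (by simp)).smul_measure_nnreal

lemma memLp_id_signMeasure (p : ℝ≥0∞) : MemLp id p signMeasure := by
  refine MemLp.of_bound (by fun_prop) 1 ?_
  filter_upwards [ae_sq_eq_one_signMeasure] with x hx
  rw [id, Real.norm_eq_abs, ← sq_le_one_iff_abs_le_one, hx]

section EntryMeasure

variable {q : ℝ}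

lemma isProbabilityMeasure_fjltEntryMeasure (hq0 : 0 < q) (hq1 : q ≤ 1) :
    IsProbabilityMeasure (fjltEntryMeasure q) := by
  refine ⟨?_⟩
  simp only [fjltEntryMeasure, Measure.add_apply, Measure.smul_apply, measure_univ,
    ENNReal.smul_def, smul_eq_mul, mul_one]
  rw [← ENNReal.coe_add, ← Real.toNNReal_add hq0.le (by linarith)]
  simp

lemma integrable_pow_fjltEntryMeasure (n : ℕ) :
    Integrable (fun x => x ^ n) (fjltEntryMeasure q) := by
  refine Integrable.add_measure ?_ ?_
  · exact (MemLp.integrable_pow_of_le (f := id) (memLp_id_gaussianReal' n (by simp))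
      le_rfl).smul_measure_nnreal
  · exact (integrable_dirac (by simp)).smul_measure_nnreal

lemma memLp_id_fjltEntryMeasure : MemLp id 4 (fjltEntryMeasure q) := by
  rw [← integrable_norm_rpow_iff (by fun_prop) (by norm_num) (by norm_num)]
  refine (integrable_pow_fjltEntryMeasure 4).congr (ae_of_all _ fun x => ?_)
  norm_num [← abs_pow, abs_of_nonneg (Even.pow_nonneg (by decide : Even 4) x)]

lemma integral_pow_fjltEntryMeasure (hq0 : 0 < q) {n : ℕ} (hn : n ≠ 0) :
    ∫ x, x ^ n ∂(fjltEntryMeasure q) = q * ∫ x, x ^ n ∂(gaussianReal 0 q.toNNReal⁻¹) := by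
  rw [fjltEntryMeasure, integral_add_measure, integral_smul_nnreal_measure,
    integral_smul_nnreal_measure, integral_dirac]
  · simp [NNReal.smul_def, hq0.le, hn]
  · exact (MemLp.integrable_pow_of_le (f := id) (memLp_id_gaussianReal' n (by simp))
      le_rfl).smul_measure_nnreal
  · exact (integrable_dirac (by simp)).smul_measure_nnreal

lemma integral_fjltEntryMeasure (hq0 : 0 < q) : ∫ x, x ∂(fjltEntryMeasure q) = 0 := by
  simpa using integral_pow_fjltEntryMeasure hq0 one_ne_zero

lemma integral_sq_fjltEntryMeasure (hq0 : 0 < q) : ∫ x, x ^ 2 ∂(fjltEntryMeasure q) = 1 := by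
  have h := variance_id_gaussianReal (μ := 0) (v := q.toNNReal⁻¹)
  rw [variance_eq_integral (by fun_prop)] at h
  simp only [id, integral_id_gaussianReal, sub_zero] at h
  rw [integral_pow_fjltEntryMeasure hq0 two_ne_zero, h]
  simp [hq0.le, hq0.ne']

lemma integral_pow_four_fjltEntryMeasure (hq0 : 0 < q) :
    ∫ x, x ^ 4 ∂(fjltEntryMeasure q) = 3 / q := by
  rw [integral_pow_fjltEntryMeasure hq0 four_ne_zero, integral_pow_four_gaussianReal_zero]
  simp only [NNReal.coe_inv, Real.coe_toNNReal q hq0.le]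
  field_simp

end EntryMeasure

section Hadamard

variable {m : ℕ}

lemma hadamardMat_eq_prod (f j : Fin (2 ^ m)) :
    hadamardMat m f j = (∏ b ∈ Finset.range m,
      if f.val.testBit b && j.val.testBit b then (-1 : ℝ) else 1) / Real.sqrt (2 ^ m) := by
  rw [hadamardMat, ← Finset.prod_pow_eq_pow_sum]
  congr 1
  exact Finset.prod_congr rfl fun b _ => by split_ifs <;> simp

lemma hadamardMat_sq (f j : Fin (2 ^ m)) : hadamardMat m f j ^ 2 = 1 / 2 ^ m := by
  rw [hadamardMat, div_pow, Real.sq_sqrt (by positivity), ← pow_mul, mul_comm, pow_mul]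
  simp

/-- Flipping the `b`-th binary digit. -/
def flipBit (b : ℕ) (hb : b < m) : Equiv.Perm (Fin (2 ^ m)) :=
  Function.Involutive.toPerm
    (fun f => ⟨f.val ^^^ 2 ^ b, Nat.xor_lt_two_pow f.2 (Nat.pow_lt_pow_right (by lia) hb)⟩)
    fun f => by ext; simp

lemma hadamardMat_flipBit {b : ℕ} (hb : b < m) (f j : Fin (2 ^ m)) :
    hadamardMat m (flipBit b hb f) j
      = (if j.val.testBit b then -1 else 1) * hadamardMat m f j := by
  have h : (if j.val.testBit b then (-1 : ℝ) else 1)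
      = ∏ c ∈ Finset.range m, if c = b then (if j.val.testBit c then (-1 : ℝ) else 1) else 1 := by
    rw [Finset.prod_ite_eq' (Finset.range m) b]
    simp [hb]
  rw [hadamardMat_eq_prod, hadamardMat_eq_prod, h, ← mul_div_assoc, ← Finset.prod_mul_distrib]
  congr 1
  refine Finset.prod_congr rfl fun c _ => ?_
  have hbit : (flipBit b hb f).val.testBit c = (f.val.testBit c ^^ decide (b = c)) := by
    change (f.val ^^^ 2 ^ b).testBit c = _
    rw [Nat.testBit_xor, Nat.testBit_two_pow]
  rw [hbit]
  by_cases hc : c = b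
  · subst hc
    cases f.val.testBit c <;> cases j.val.testBit c <;> simp
  · simp [hc, Ne.symm hc]

lemma sum_hadamardMat_mul_of_ne {j l : Fin (2 ^ m)} (hjl : j ≠ l) :
    ∑ f, hadamardMat m f j * hadamardMat m f l = 0 := by
  obtain ⟨b, hb⟩ : ∃ b, j.val.testBit b ≠ l.val.testBit b := by
    by_contra! h
    exact hjl (Fin.ext (Nat.eq_of_testBit_eq h))
  have hbm : b < m := by
    by_contra! h
    have hpow : 2 ^ m ≤ 2 ^ b := Nat.pow_le_pow_right (by lia) h
    exact hb (by rw [Nat.testBit_lt_two_pow (j.2.trans_le hpow),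
      Nat.testBit_lt_two_pow (l.2.trans_le hpow)])
  have h := Equiv.sum_comp (flipBit b hbm) fun f => hadamardMat m f j * hadamardMat m f l
  have hneg (f : Fin (2 ^ m)) : hadamardMat m (flipBit b hbm f) j
      * hadamardMat m (flipBit b hbm f) l = -(hadamardMat m f j * hadamardMat m f l) := by
    rw [hadamardMat_flipBit, hadamardMat_flipBit]
    cases hj : j.val.testBit b <;> cases hl : l.val.testBit b <;> simp_all
  simp_rw [hneg, Finset.sum_neg_distrib] at h
  linarith

lemma sum_sq_sum_hadamardMat_mul (w : Fin (2 ^ m) → ℝ) :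
    ∑ f, (∑ j, hadamardMat m f j * w j) ^ 2 = ∑ j, w j ^ 2 := by
  simp_rw [sq (∑ j, _ * _), Finset.sum_mul_sum]
  rw [Finset.sum_comm]
  refine Finset.sum_congr rfl fun j _ => ?_
  rw [Finset.sum_comm, Finset.sum_eq_single j]
  · simp_rw [← sq, mul_pow, hadamardMat_sq, Finset.sum_const]
    simp
  · intro l _ hl
    simp_rw [mul_mul_mul_comm _ (w j), ← Finset.sum_mul, sum_hadamardMat_mul_of_ne hl.symm, zero_mul]
  · simp

end Hadamard

/-- Mean and variance of the mean of squares of i.i.d. rows, each row being a linear combination of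
independent standardized variables with common fourth moment `c`. -/
lemma variance_mean_sq_of_iIndepFun {Ω ι κ : Type*} [MeasurableSpace Ω] {μ : Measure Ω}
    [IsProbabilityMeasure μ] [Fintype ι] [Nonempty ι] [Fintype κ] {ξ : ι × κ → Ω → ℝ}
    (hξ : iIndepFun ξ μ) (hm : ∀ i, Measurable (ξ i)) (hL : ∀ i, MemLp (ξ i) 4 μ) {c : ℝ}
    (h1 : ∀ i, ∫ ω, ξ i ω ∂μ = 0) (h2 : ∀ i, ∫ ω, ξ i ω ^ 2 ∂μ = 1)
    (h4 : ∀ i, ∫ ω, ξ i ω ^ 4 ∂μ = c) (u : κ → ℝ) {X : Ω → ℝ}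
    (hX : X = fun ω => 1 / (Fintype.card ι : ℝ) * ∑ i, (∑ f, u f * ξ (i, f) ω) ^ 2) :
    MemLp X 2 μ ∧ ∫ ω, X ω ∂μ = ∑ f, u f ^ 2 ∧
    variance X μ = 1 / (Fintype.card ι : ℝ)
      * (2 * (∑ f, u f ^ 2) ^ 2 + (c - 3) * ∑ f, u f ^ 4) := by
  classical
  have hcard : (Fintype.card ι : ℝ) ≠ 0 := by simp
  set Y : ι → Ω → ℝ := fun i ω => ∑ f, u f * ξ (i, f) ω with hY
  have hYL (i : ι) : MemLp (Y i) 4 μ := memLp_finsetSum _ fun f _ => (hL (i, f)).const_mul _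
  have hYm (i : ι) : Measurable (Y i) := by
    refine Finset.measurable_fun_sum _ fun f _ => ?_
    have := hm (i, f)
    fun_prop
  have hYi (i : ι) (n : ℕ) (hn : n ≤ 4) : Integrable (fun ω => Y i ω ^ n) μ :=
    MemLp.integrable_pow_of_le (N := 4) (by exact_mod_cast hYL i) hn
  have hmom (i : ι) := integral_sum_mul_pow_of_iIndepFun
    (hξ.precomp (g := fun f => (i, f)) (Prod.mk_right_injective i))
    (fun f => hm (i, f)) (fun f => hL (i, f)) (fun f => h1 (i, f)) (fun f => h2 (i, f))
    (fun f => h4 (i, f)) u Finset.univ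
  have hY2L (i : ι) : MemLp (fun ω => Y i ω ^ 2) 2 μ := by
    rw [memLp_two_iff_integrable_sq (by have := hYm i; fun_prop)]
    simpa only [← pow_mul] using hYi i 4 le_rfl
  have hYvar (i : ι) : variance (fun ω => Y i ω ^ 2) μ
      = 2 * (∑ f, u f ^ 2) ^ 2 + (c - 3) * ∑ f, u f ^ 4 := by
    rw [variance_eq_sub (hY2L i)]
    have e2 : ∫ ω, Y i ω ^ 2 ∂μ = ∑ f, u f ^ 2 := (hmom i).2.1
    have e4 : ∫ ω, Y i ω ^ 4 ∂μ = _ := (hmom i).2.2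
    simp only [Pi.pow_apply, ← pow_mul]
    rw [e2, e4]
    ring
  have hYind : Set.Pairwise (Finset.univ : Finset ι) fun i j =>
      IndepFun (fun ω => Y i ω ^ 2) (fun ω => Y j ω ^ 2) μ := by
    intro i _ j _ hij
    have hdisj : Disjoint (({i} : Finset ι) ×ˢ (Finset.univ : Finset κ)) ({j} ×ˢ Finset.univ) := by
      rw [Finset.disjoint_product]
      simp [hij]
    have hmem (i : ι) (f : κ) : (i, f) ∈ ({i} : Finset ι) ×ˢ (Finset.univ : Finset κ) := by simp
    have h := (hξ.indepFun_finset _ _ hdisj hm).comp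
      (φ := fun a => (∑ f, u f * a ⟨(i, f), hmem i f⟩) ^ 2)
      (ψ := fun a => (∑ f, u f * a ⟨(j, f), hmem j f⟩) ^ 2) (by fun_prop) (by fun_prop)
    exact h
  have hvar := IndepFun.variance_sum (fun i _ => hY2L i) hYind
  subst hX
  refine ⟨(memLp_finsetSum _ fun i _ => hY2L i).const_mul _, ?_, ?_⟩
  · rw [integral_const_mul, integral_finsetSum _ fun i _ => hYi i 2 (by lia)]
    have e2 (i : ι) : ∫ ω, Y i ω ^ 2 ∂μ = ∑ f, u f ^ 2 := (hmom i).2.1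
    simp_rw [e2]
    simp [hcard]
  · rw [variance_const_mul]
    have e : (fun ω => ∑ i, Y i ω ^ 2) = ∑ i, fun ω => Y i ω ^ 2 := by ext; simp
    rw [e, hvar]
    simp_rw [hYvar]
    simp only [Finset.sum_const, Finset.card_univ, nsmul_eq_mul]
    field_simp

section PiCoordinates

variable {ι : Type*} [Fintype ι] {ρ : Measure ℝ} [IsProbabilityMeasure ρ]

lemma iIndepFun_eval_pi : iIndepFun (fun (i : ι) (p : ι → ℝ) => p i) (Measure.pi fun _ => ρ) :=
  iIndepFun_pi (X := fun _ => id) fun _ => aemeasurable_id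

lemma memLp_eval_pi {p : ℝ≥0∞} (h : MemLp id p ρ) (i : ι) :
    MemLp (fun a : ι → ℝ => a i) p (Measure.pi fun _ => ρ) :=
  h.comp_measurePreserving (measurePreserving_eval (fun _ => ρ) i)

lemma integral_pow_eval_pi (n : ℕ) (i : ι) :
    ∫ a : ι → ℝ, a i ^ n ∂(Measure.pi fun _ => ρ) = ∫ x, x ^ n ∂ρ := by
  have h := integral_map (μ := Measure.pi fun _ : ι => ρ) (φ := Function.eval i)
    (f := fun x : ℝ => x ^ n) (measurable_pi_apply i).aemeasurable (by fun_prop)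
  rw [(measurePreserving_eval (fun _ : ι => ρ) i).map_eq] at h
  exact h.symm

end PiCoordinates

section Signs

variable {m : ℕ}

lemma sum_sq_hadamardMat_sign {δ : Fin (2 ^ m) → ℝ} (hδ : ∀ j, δ j ^ 2 = 1)
    (z : Fin (2 ^ m) → ℝ) :
    ∑ f, (∑ j, hadamardMat m f j * z j * δ j) ^ 2 = ∑ j, z j ^ 2 := by
  simp_rw [mul_assoc, sum_sq_sum_hadamardMat_mul fun j => z j * δ j, mul_pow, hδ, mul_one]

lemma integral_pow_four_hadamardMat_sign_le (z : Fin (2 ^ m) → ℝ) (f : Fin (2 ^ m)) :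
    ∫ δ : Fin (2 ^ m) → ℝ, (∑ j, hadamardMat m f j * z j * δ j) ^ 4
      ∂(Measure.pi fun _ => signMeasure) ≤ 3 * ((∑ j, z j ^ 2) / 2 ^ m) ^ 2 := by
  have h := (integral_sum_mul_pow_of_iIndepFun (ι := Fin (2 ^ m)) (κ := 1)
    (iIndepFun_eval_pi (ρ := signMeasure)) (fun i => by fun_prop)
    (fun i => memLp_eval_pi (memLp_id_signMeasure 4) i)
    (fun i => by simpa [integral_signMeasure] using integral_pow_eval_pi (ρ := signMeasure) 1 i)
    (fun i => by rw [integral_pow_eval_pi, integral_signMeasure]; norm_num)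
    (fun i => by rw [integral_pow_eval_pi, integral_signMeasure]; norm_num)
    (fun j => hadamardMat m f j * z j) Finset.univ).2.2
  have hsum : ∑ j, (hadamardMat m f j * z j) ^ 2 = (∑ j, z j ^ 2) / 2 ^ m := by
    simp_rw [mul_pow, hadamardMat_sq, ← Finset.mul_sum]
    ring
  rw [h, hsum]
  have : 0 ≤ ∑ j, (hadamardMat m f j * z j) ^ 4 := Finset.sum_nonneg fun j _ => by positivity
  linarith

lemma integrable_pow_four_sum_mul_sign (a : Fin (2 ^ m) → ℝ) :
    Integrable (fun δ : Fin (2 ^ m) → ℝ => (∑ j, a j * δ j) ^ 4)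
      (Measure.pi fun _ => signMeasure) :=
  MemLp.integrable_pow_of_le (N := 4)
    (memLp_finsetSum _ fun j _ => (memLp_eval_pi (memLp_id_signMeasure 4) j).const_mul (a j)) le_rfl

end Signs

lemma sum_fjltEntry_mul_sub {m k : ℕ} (p : Fin k × Fin (2 ^ m) → ℝ) (δ x y : Fin (2 ^ m) → ℝ)
    (i : Fin k) :
    (∑ j, fjltEntry p δ i j * x j) - (∑ j, fjltEntry p δ i j * y j)
      = ∑ f, (∑ j, hadamardMat m f j * (x j - y j) * δ j) * p (i, f) := by
  rw [← Finset.sum_sub_distrib]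
  simp_rw [← mul_sub, fjltEntry, Finset.sum_mul]
  rw [Finset.sum_comm]
  exact Finset.sum_congr rfl fun f _ => Finset.sum_congr rfl fun j _ => by ring

/-- Conditionally on the signs, the mean squared deviation of the squared norm. -/
lemma lintegral_sq_mean_sq_sub {m k : ℕ} (hk : 0 < k) {q : ℝ} (hq0 : 0 < q) (hq1 : q ≤ 1)
    (u : Fin (2 ^ m) → ℝ) :
    ∫⁻ p : Fin k × Fin (2 ^ m) → ℝ, ENNReal.ofReal
        ((1 / (k : ℝ) * ∑ i, (∑ f, u f * p (i, f)) ^ 2 - ∑ f, u f ^ 2) ^ 2)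
        ∂(Measure.pi fun _ => fjltEntryMeasure q)
      = ENNReal.ofReal (1 / (k : ℝ) *
          (2 * (∑ f, u f ^ 2) ^ 2 + (3 / q - 3) * ∑ f, u f ^ 4)) := by
  have := isProbabilityMeasure_fjltEntryMeasure hq0 hq1
  have : Nonempty (Fin k) := ⟨⟨0, hk⟩⟩
  obtain ⟨hL, hmean, hvar⟩ := variance_mean_sq_of_iIndepFun (ι := Fin k) (κ := Fin (2 ^ m))
    (iIndepFun_eval_pi (ρ := fjltEntryMeasure q)) (fun i => by fun_prop)
    (fun i => memLp_eval_pi memLp_id_fjltEntryMeasure i)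
    (fun i => by
      simpa [integral_fjltEntryMeasure hq0] using
        integral_pow_eval_pi (ρ := fjltEntryMeasure q) 1 i)
    (fun i => by rw [integral_pow_eval_pi, integral_sq_fjltEntryMeasure hq0])
    (fun i => by rw [integral_pow_eval_pi, integral_pow_four_fjltEntryMeasure hq0]) u rfl
  rw [Fintype.card_fin] at hL hmean hvar
  rw [← hvar, variance_eq_integral hL.aemeasurable, hmean, ofReal_integral_eq_lintegral_ofReal]
  · exact (hL.sub (memLp_const _)).integrable_sq
  · exact ae_of_all _ fun p => sq_nonneg _

/-- For the FJLT `Φ` with sparsity parameter `q ≥ 9/(d+9)` (`d = 2^m`),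
for all `x, y ∈ ℝ^d`: `Var[(1/k)·‖Φx − Φy‖₂²] ≤ (3/k)·‖x−y‖₂⁴`. -/
theorem fjlt_variance_bound
    {Ω : Type*} [MeasurableSpace Ω] (Pr : Measure Ω) [IsProbabilityMeasure Pr]
    (m k : ℕ) (hk : 0 < k) (q : ℝ) (hq0 : 0 < q) (hq1 : q ≤ 1)
    (hq9 : 9 / ((2 ^ m : ℝ) + 9) ≤ q)
    (P : Ω → (Fin k × Fin (2 ^ m)) → ℝ) (hPmeas : Measurable P)
    (hPlaw : Measure.map P Pr = Measure.pi (fun _ => fjltEntryMeasure q))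
    (D : Ω → Fin (2 ^ m) → ℝ) (hDmeas : Measurable D)
    (hDlaw : Measure.map D Pr = Measure.pi (fun _ => signMeasure))
    (hindep : IndepFun P D Pr)
    (x y : Fin (2 ^ m) → ℝ) :
    variance (fun ω =>
        (1 / (k : ℝ)) * ∑ i : Fin k,
          ((∑ j, fjltEntry (P ω) (D ω) i j * x j)
            - (∑ j, fjltEntry (P ω) (D ω) i j * y j)) ^ 2) Pr
      ≤ (3 / (k : ℝ)) * (∑ j, (x j - y j) ^ 2) ^ 2 := by
  have hρ := isProbabilityMeasure_fjltEntryMeasure hq0 hq1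
  set z : Fin (2 ^ m) → ℝ := fun j => x j - y j
  set S : ℝ := ∑ j, z j ^ 2 with hS
  let u (δ : Fin (2 ^ m) → ℝ) (f : Fin (2 ^ m)) : ℝ := ∑ j, hadamardMat m f j * z j * δ j
  let G (a : (Fin k × Fin (2 ^ m) → ℝ) × (Fin (2 ^ m) → ℝ)) : ℝ :=
    1 / (k : ℝ) * ∑ i, (∑ f, u a.2 f * a.1 (i, f)) ^ 2
  let h (δ : Fin (2 ^ m) → ℝ) : ℝ :=
    1 / (k : ℝ) * (2 * S ^ 2 + (3 / q - 3) * ∑ f, u δ f ^ 4)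
  have hq3 : 0 ≤ 3 / q - 3 := by
    rw [sub_nonneg, le_div_iff₀ hq0]
    linarith
  have hGm : Measurable G := by fun_prop
  have hPDm : Measurable fun ω => (P ω, D ω) := hPmeas.prodMk hDmeas
  have hlaw : Measure.map (fun ω => (P ω, D ω)) Pr
      = (Measure.pi fun _ => fjltEntryMeasure q).prod (Measure.pi fun _ => signMeasure) := by
    rw [hindep.map_prod_eq_prod_map_map hPmeas.aemeasurable hDmeas.aemeasurable, hPlaw, hDlaw]
  have hcond : ∀ᵐ δ ∂(Measure.pi fun _ : Fin (2 ^ m) => signMeasure),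
      ∫⁻ p, ENNReal.ofReal ((G (p, δ) - S) ^ 2) ∂(Measure.pi fun _ => fjltEntryMeasure q)
        = ENNReal.ofReal (h δ) := by
    have hsign : ∀ᵐ δ ∂(Measure.pi fun _ : Fin (2 ^ m) => signMeasure), ∀ j, δ j ^ 2 = 1 :=
      ae_all_iff.2 fun j => (measurePreserving_eval (fun _ => signMeasure) j).quasiMeasurePreserving.ae
        ae_sq_eq_one_signMeasure
    filter_upwards [hsign] with δ hδ
    have hu : ∑ f, u δ f ^ 2 = S := sum_sq_hadamardMat_sign hδ z
    simpa only [hu] using lintegral_sq_mean_sq_sub hk hq0 hq1 (u δ)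
  have hu_int (f : Fin (2 ^ m)) :
      Integrable (fun δ => u δ f ^ 4) (Measure.pi fun _ : Fin (2 ^ m) => signMeasure) :=
    integrable_pow_four_sum_mul_sign _
  have hh_int : Integrable h (Measure.pi fun _ : Fin (2 ^ m) => signMeasure) :=
    ((integrable_const _).add ((integrable_finsetSum _ fun f _ => hu_int f).const_mul _)).const_mul _
  have hh0 (δ : Fin (2 ^ m) → ℝ) : 0 ≤ h δ := by
    have : 0 ≤ ∑ f, u δ f ^ 4 := Finset.sum_nonneg fun f _ => by positivity
    positivity
  have hhle : ∫ δ, h δ ∂(Measure.pi fun _ : Fin (2 ^ m) => signMeasure)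
      ≤ 3 / (k : ℝ) * S ^ 2 := by
    have hsum : ∑ f, ∫ δ, u δ f ^ 4 ∂(Measure.pi fun _ : Fin (2 ^ m) => signMeasure)
        ≤ 3 * S ^ 2 / 2 ^ m := by
      refine (Finset.sum_le_sum fun f _ => integral_pow_four_hadamardMat_sign_le z f).trans_eq ?_
      simp only [Finset.sum_const, Finset.card_univ, Fintype.card_fin, nsmul_eq_mul]
      rw [← hS]
      push_cast
      field_simp
    have hcoef : (3 / q - 3) * (3 / 2 ^ m) ≤ 1 := by
      rw [div_le_iff₀ (by positivity)] at hq9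
      rw [← sub_nonneg]
      have : 1 - (3 / q - 3) * (3 / 2 ^ m) = (q * (2 ^ m + 9) - 9) / (q * 2 ^ m) := by
        field_simp
        ring
      rw [this]
      exact div_nonneg (by linarith) (by positivity)
    simp only [h]
    rw [integral_const_mul, integral_add (integrable_const _)
      ((integrable_finsetSum _ fun f _ => hu_int f).const_mul _), integral_const_mul (3 / q - 3),
      integral_finsetSum _ fun f _ => hu_int f]
    simp only [integral_const, probReal_univ, one_smul]
    calc _ ≤ 1 / (k : ℝ) * (2 * S ^ 2 + (3 / q - 3) * (3 * S ^ 2 / 2 ^ m)) := by gcongr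
      _ = 1 / (k : ℝ) * (2 * S ^ 2 + ((3 / q - 3) * (3 / 2 ^ m)) * S ^ 2) := by ring
      _ ≤ 1 / (k : ℝ) * (2 * S ^ 2 + 1 * S ^ 2) := by gcongr
      _ = _ := by ring
  simp_rw [sum_fjltEntry_mul_sub]
  change variance (fun ω => G (P ω, D ω)) Pr ≤ _
  have hXm : Measurable fun ω => G (P ω, D ω) := hGm.comp hPDm
  rw [← variance_sub_const hXm.aestronglyMeasurable S]
  refine (variance_le_expectation_sq (by fun_prop)).trans (le_trans (le_of_eq ?_) hhle)
  simp only [Pi.pow_apply]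
  rw [← integral_map (f := fun a => (G a - S) ^ 2) hPDm.aemeasurable (by fun_prop), hlaw,
    integral_eq_lintegral_of_nonneg_ae (ae_of_all _ fun a => sq_nonneg _) (by fun_prop),
    lintegral_prod_symm' _ (by fun_prop), lintegral_congr_ae hcond,
    integral_eq_lintegral_of_nonneg_ae (ae_of_all _ hh0) hh_int.1]
end
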